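/- arXiv:2204.07345 — 2 statements merged into one kernel-verified Lean document; each statement's English description precedes it below -/
import Mathlib

section
/- Let n ≥ 2 be a natural number and let A be a nonempty subset of Z_n. Then E_A(n) = D_A(n) + n − 1. -/
open Classical in
/-- The number of terms of the sequence `S` satisfying the predicate `P`. -/
noncomputable def pcount {α : Type*} (P : α → Prop) (S : List α) : ℕ :=
  S.countP fun x => decide (P x)

/-- `S` is an `A`-weighted zero-sum sequence in `ZMod n`: there are weights
`a i ∈ A` with `∑ a i * x i = 0`. -/
def IsWZSum {n : ℕ} (A : Set (ZMod n)) (S : List (ZMod n)) : Prop :=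
  ∃ w : List (ZMod n), w.length = S.length ∧ (∀ a ∈ w, a ∈ A) ∧
    (List.zipWith (· * ·) w S).sum = 0

/-- `S` has an `A`-weighted zero-sum subsequence of length `t ≥ 1`. -/
def HasWZSS {n : ℕ} (A : Set (ZMod n)) (S : List (ZMod n)) (t : ℕ) : Prop :=
  0 < t ∧ ∃ T : List (ZMod n), T.Sublist S ∧ T.length = t ∧ IsWZSum A T

/-- `S` has a nonempty `A`-weighted zero-sum subsequence. -/
def HasWZS {n : ℕ} (A : Set (ZMod n)) (S : List (ZMod n)) : Prop :=
  ∃ T : List (ZMod n), T.Sublist S ∧ T ≠ [] ∧ IsWZSum A T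

/-- The `A`-weighted Davenport constant `D_A(n)`: the least `k > 0` such that every
sequence of length `k` in `ZMod n` has a nonempty `A`-weighted zero-sum subsequence. -/
noncomputable def DavC (n : ℕ) (A : Set (ZMod n)) : ℕ :=
  sInf {k | 0 < k ∧ ∀ S : List (ZMod n), S.length = k → HasWZS A S}

/-- The `A`-weighted Gao constant `E_A(n)`: the least `k > 0` such that every
sequence of length `k` in `ZMod n` has an `A`-weighted zero-sum subsequence of length `n`. -/
noncomputable def GaoC (n : ℕ) (A : Set (ZMod n)) : ℕ :=
  sInf {k | 0 < k ∧ ∀ S : List (ZMod n), S.length = k → HasWZSS A S n}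

/-- The set of units of `ZMod n`. -/
def U (n : ℕ) : Set (ZMod n) := {x | IsUnit x}

/-- An `A`-extremal sequence for the Gao constant: a sequence of length `E_A(n) - 1`
with no `A`-weighted zero-sum subsequence of length `n`. -/
def IsGaoExtremal (n : ℕ) (A : Set (ZMod n)) (S : List (ZMod n)) : Prop :=
  S.length = GaoC n A - 1 ∧ ¬ HasWZSS A S n

/-- `S` and `T` are `A`-equivalent: there are a unit `c`, weights `a i ∈ A` and a
permutation matching the multiset of terms `c * y j` with the multiset `a i * x i`. -/
def AEquiv {n : ℕ} (A : Set (ZMod n)) (S T : List (ZMod n)) : Prop :=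
  ∃ c : ZMod n, IsUnit c ∧ ∃ w : List (ZMod n), w.length = S.length ∧
    (∀ a ∈ w, a ∈ A) ∧ (T.map fun y => c * y).Perm (List.zipWith (· * ·) w S)

open scoped Pointwise

section AdditiveCombinatorics

variable {G : Type*} [AddCommGroup G]

/-- The subgroup of periods of a subset of an abelian group. -/
def period (X : Set G) : AddSubgroup G where
  carrier := {g | ∀ x, g + x ∈ X ↔ x ∈ X}
  zero_mem' := by simp
  add_mem' := by
    intro a b ha hb x
    rw [add_assoc, ha, hb]
  neg_mem' := by
    intro a ha x
    rw [← ha (-a + x), add_neg_cancel_left]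

/-- The union of all cosets of `K` that meet `X`. -/
def saturation (K : AddSubgroup G) (X : Set G) : Set G := {g | ∃ x ∈ X, g - x ∈ K}

/-- The part of `X` lying in the coset `r + K`. -/
def cosetSlice (X : Set G) (K : AddSubgroup G) (r : G) : Set G := {g | g ∈ X ∧ g - r ∈ K}

theorem mem_cosetSlice {X : Set G} {K : AddSubgroup G} {r g : G} :
    g ∈ cosetSlice X K r ↔ g ∈ X ∧ g - r ∈ K := Iff.rfl

theorem le_period_iff {K : AddSubgroup G} {X : Set G} :
    K ≤ period X ↔ ∀ g ∈ K, ∀ x ∈ X, g + x ∈ X := by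
  refine ⟨fun h g hg x hx => (h hg x).2 hx, fun h g hg x => ⟨fun hx => ?_, h g hg x⟩⟩
  simpa using h (-g) (K.neg_mem hg) _ hx

theorem mem_of_le_period {K : AddSubgroup G} {X : Set G} (h : K ≤ period X) {x y : G}
    (hx : x ∈ X) (hxy : y - x ∈ K) : y ∈ X := by
  simpa using le_period_iff.1 h _ hxy _ hx

theorem subset_saturation (K : AddSubgroup G) (X : Set G) : X ⊆ saturation K X :=
  fun x hx => ⟨x, hx, by simp⟩

theorem le_period_saturation (K : AddSubgroup G) (X : Set G) : K ≤ period (saturation K X) := by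
  rw [le_period_iff]
  rintro g hg x ⟨y, hy, hxy⟩
  exact ⟨y, hy, by simpa [add_sub_assoc] using K.add_mem hg hxy⟩

theorem saturation_eq_self {K : AddSubgroup G} {X : Set G} (h : K ≤ period X) :
    saturation K X = X := by
  refine Set.Subset.antisymm ?_ (subset_saturation K X)
  rintro g ⟨x, hx, hgx⟩
  exact mem_of_le_period h hx hgx

theorem saturation_mono {K L : AddSubgroup G} (hKL : K ≤ L) {X Y : Set G} (hXY : X ⊆ Y) :
    saturation K X ⊆ saturation L Y := by
  rintro g ⟨x, hx, hgx⟩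
  exact ⟨x, hXY hx, hKL hgx⟩

theorem saturation_saturation {K L : AddSubgroup G} (hKL : K ≤ L) (X : Set G) :
    saturation L (saturation K X) = saturation L X := by
  refine Set.Subset.antisymm ?_ (saturation_mono le_rfl (subset_saturation K X))
  rintro g ⟨x, ⟨y, hy, hxy⟩, hgx⟩
  exact ⟨y, hy, by simpa using L.add_mem hgx (hKL hxy)⟩

theorem saturation_nonempty {K : AddSubgroup G} {X : Set G} :
    (saturation K X).Nonempty ↔ X.Nonempty :=
  ⟨fun ⟨_, x, hx, _⟩ => ⟨x, hx⟩, fun h => h.mono (subset_saturation K X)⟩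

theorem inf_period_le_period_union (X Y : Set G) : period X ⊓ period Y ≤ period (X ∪ Y) := by
  rintro g ⟨hX, hY⟩ x
  exact or_congr (hX x) (hY x)

theorem le_period_add_left {K : AddSubgroup G} {X : Set G} (h : K ≤ period X) (Y : Set G) :
    K ≤ period (X + Y) := by
  rw [le_period_iff]
  rintro g hg _ ⟨x, hx, y, hy, rfl⟩
  exact ⟨g + x, le_period_iff.1 h g hg x hx, y, hy, by simp [add_assoc]⟩

theorem le_period_add_right {K : AddSubgroup G} {Y : Set G} (h : K ≤ period Y) (X : Set G) :
    K ≤ period (X + Y) := by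
  rw [add_comm]; exact le_period_add_left h X

theorem saturation_add_saturation (K : AddSubgroup G) (X Y : Set G) :
    saturation K X + saturation K Y = saturation K (X + Y) := by
  ext g
  constructor
  · rintro ⟨x, ⟨x', hx', hx⟩, y, ⟨y', hy', hy⟩, rfl⟩
    exact ⟨x' + y', ⟨x', hx', y', hy', rfl⟩, by simpa [add_sub_add_comm] using K.add_mem hx hy⟩
  · rintro ⟨_, ⟨x, hx, y, hy, rfl⟩, hg⟩
    exact ⟨g - y, ⟨x, hx, by simpa [sub_sub, add_comm] using hg⟩, y, subset_saturation K Y hy,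
      by simp⟩

variable [Finite G]

theorem ncard_mul_ncard_le {H₁ H₂ : AddSubgroup G} {V U X : Set G} (hV : V ⊆ H₁) (hU : U ⊆ H₂)
    (c : G) (hX : ∀ x ∈ V, ∀ y ∈ U, c + x + y ∈ X) :
    V.ncard * U.ncard ≤ X.ncard * Nat.card (H₁ ⊓ H₂ : AddSubgroup G) := by
  classical
  have hbase : ∀ z : G, ∃ x₀ : G, ∀ x ∈ V, ∀ y ∈ U, c + x + y = z →
      x - x₀ ∈ (H₁ ⊓ H₂ : AddSubgroup G) := by
    intro z
    by_cases h : ∃ x ∈ V, ∃ y ∈ U, c + x + y = z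
    · obtain ⟨x₀, hx₀, y₀, hy₀, h₀⟩ := h
      refine ⟨x₀, fun x hx y hy hz => ⟨H₁.sub_mem (hV hx) (hV hx₀), ?_⟩⟩
      have : x - x₀ = y₀ - y := by
        have := hz.trans h₀.symm
        rw [sub_eq_sub_iff_add_eq_add]
        rw [add_assoc, add_assoc] at this
        rw [add_left_cancel this, add_comm]
      rw [this]
      exact H₂.sub_mem (hU hy₀) (hU hy)
    · push Not at h
      exact ⟨0, fun x hx y hy hz => absurd hz (h x hx y hy)⟩
  choose b hb using hbase
  have hcard : Nat.card (H₁ ⊓ H₂ : AddSubgroup G) = ((H₁ ⊓ H₂ : AddSubgroup G) : Set G).ncard :=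
    Nat.card_coe_set_eq _
  rw [hcard, ← Set.ncard_prod, ← Set.ncard_prod]
  refine Set.ncard_le_ncard_of_injOn
    (fun p => (c + p.1 + p.2, p.1 - b (c + p.1 + p.2))) ?_ ?_ (Set.toFinite _)
  · rintro ⟨x, y⟩ ⟨hx, hy⟩
    exact ⟨hX x hx y hy, hb _ x hx y hy rfl⟩
  · rintro ⟨x, y⟩ - ⟨x', y'⟩ - h
    simp only [Prod.mk.injEq] at h
    obtain ⟨h1, h2⟩ := h
    rw [h1] at h2
    have hx : x = x' := by simpa using h2
    subst hx
    simpa using h1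

theorem card_le_ncard_of_le_period {K : AddSubgroup G} {X : Set G} (h : K ≤ period X)
    (hX : X.Nonempty) : Nat.card K ≤ X.ncard := by
  obtain ⟨x, hx⟩ := hX
  have : Nat.card K = (K : Set G).ncard := Nat.card_coe_set_eq _
  rw [this]
  refine Set.ncard_le_ncard_of_injOn (fun g => g + x) (fun g hg => ?_) ?_ (Set.toFinite _)
  · exact le_period_iff.1 h g hg x hx
  · intro a _ b _ hab
    simpa using hab

theorem sdiff_period_bound {C₁ C₂ : Set G} {c : G} (hc₂ : c ∈ C₂) (hc₁ : c ∉ C₁) :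
    Nat.card (period C₁) ≤ (C₂ \ C₁).ncard + Nat.card (period C₁ ⊓ period C₂ : AddSubgroup G) ∨
    Nat.card (period C₂) ≤ (C₁ \ C₂).ncard + Nat.card (period C₁ ⊓ period C₂ : AddSubgroup G) ∨
    Nat.card (period C₂) ≤ (C₂ \ C₁).ncard := by
  set H₁ := period C₁ with hH₁
  set H₂ := period C₂ with hH₂
  have h1 : Nat.card H₁ = (H₁ : Set G).ncard := Nat.card_coe_set_eq _
  have h2 : Nat.card H₂ = (H₂ : Set G).ncard := Nat.card_coe_set_eq _
  have hpos : 0 < Nat.card (H₁ ⊓ H₂ : AddSubgroup G) := Nat.card_pos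
  set h := Nat.card (H₁ ⊓ H₂ : AddSubgroup G) with hh
  let V : Set G := {x | x ∈ H₁ ∧ c + x ∈ C₂}
  let V' : Set G := {x | x ∈ H₁ ∧ c + x ∉ C₂}
  let W : Set G := {x | x ∈ H₂ ∧ c + x ∉ C₁}
  let W' : Set G := {x | x ∈ H₂ ∧ c + x ∈ C₁}
  have hVV : V.ncard + V'.ncard = Nat.card H₁ := by
    rw [h1, ← Set.ncard_union_eq]
    · congr 1
      ext x
      by_cases hx : c + x ∈ C₂ <;> simp [V, V', hx]
    · rw [Set.disjoint_left]
      rintro x ⟨_, hx⟩ ⟨_, hx'⟩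
      exact hx' hx
  have hWW : W.ncard + W'.ncard = Nat.card H₂ := by
    rw [h2, ← Set.ncard_union_eq]
    · congr 1
      ext x
      by_cases hx : c + x ∈ C₁ <;> simp [W, W', hx]
    · rw [Set.disjoint_left]
      rintro x ⟨_, hx⟩ ⟨_, hx'⟩
      exact hx hx'
  have per₁ : ∀ g ∈ H₁, ∀ x, x + g ∈ C₁ ↔ x ∈ C₁ := fun g hg x => by rw [add_comm]; exact hg x
  have per₂ : ∀ g ∈ H₂, ∀ x, x + g ∈ C₂ ↔ x ∈ C₂ := fun g hg x => by rw [add_comm]; exact hg x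
  have hVW : V.ncard * W.ncard ≤ (C₂ \ C₁).ncard * h := by
    refine ncard_mul_ncard_le (fun x hx => hx.1) (fun x hx => hx.1) c ?_
    rintro x ⟨hx, hx'⟩ y ⟨hy, hy'⟩
    refine ⟨(per₂ y hy _).2 hx', ?_⟩
    rw [add_right_comm, per₁ x hx]
    exact hy'
  have hVW' : V'.ncard * W'.ncard ≤ (C₁ \ C₂).ncard * h := by
    refine ncard_mul_ncard_le (fun x hx => hx.1) (fun x hx => hx.1) c ?_
    rintro x ⟨hx, hx'⟩ y ⟨hy, hy'⟩
    refine ⟨?_, (per₂ y hy _).not.2 hx'⟩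
    rw [add_right_comm, per₁ x hx]
    exact hy'
  have hVper : H₁ ⊓ H₂ ≤ period V := by
    rintro g ⟨hg₁, hg₂⟩ x
    have : c + (g + x) = c + x + g := by abel
    change (_ ∧ _) ↔ (_ ∧ _)
    rw [this, per₂ g hg₂, H₁.add_mem_cancel_left hg₁]
  have hVper' : H₁ ⊓ H₂ ≤ period V' := by
    rintro g ⟨hg₁, hg₂⟩ x
    have : c + (g + x) = c + x + g := by abel
    change (_ ∧ _) ↔ (_ ∧ _)
    rw [this, per₂ g hg₂, H₁.add_mem_cancel_left hg₁]
  have hWper : H₁ ⊓ H₂ ≤ period W := by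
    rintro g ⟨hg₁, hg₂⟩ x
    have : c + (g + x) = c + x + g := by abel
    change (_ ∧ _) ↔ (_ ∧ _)
    rw [this, per₁ g hg₁, H₂.add_mem_cancel_left hg₂]
  have hWper' : H₁ ⊓ H₂ ≤ period W' := by
    rintro g ⟨hg₁, hg₂⟩ x
    have : c + (g + x) = c + x + g := by abel
    change (_ ∧ _) ↔ (_ ∧ _)
    rw [this, per₁ g hg₁, H₂.add_mem_cancel_left hg₂]
  have hV : h ≤ V.ncard :=
    card_le_ncard_of_le_period hVper ⟨0, H₁.zero_mem, by simpa using hc₂⟩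
  have hW : h ≤ W.ncard :=
    card_le_ncard_of_le_period hWper ⟨0, H₂.zero_mem, by simpa using hc₁⟩
  rcases V'.eq_empty_or_nonempty with hV' | hV'
  · left
    rw [hV', Set.ncard_empty] at hVV
    have : Nat.card H₁ ≤ (C₂ \ C₁).ncard := by
      refine Nat.le_of_mul_le_mul_right (le_trans ?_ hVW) hpos
      rw [← hVV, add_zero]
      exact Nat.mul_le_mul_left _ hW
    omega
  rcases W'.eq_empty_or_nonempty with hW' | hW'
  · right; right
    rw [hW', Set.ncard_empty] at hWW
    refine Nat.le_of_mul_le_mul_right (le_trans ?_ hVW) hpos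
    rw [← hWW, add_zero, mul_comm]
    exact Nat.mul_le_mul_right _ hV
  have hV'' : h ≤ V'.ncard := card_le_ncard_of_le_period hVper' hV'
  have hW'' : h ≤ W'.ncard := card_le_ncard_of_le_period hWper' hW'
  by_contra hcon
  push Not at hcon
  obtain ⟨hc1, hc2, -⟩ := hcon
  rw [← hVV] at hc1
  rw [← hWW] at hc2
  have e1 := Nat.mul_lt_mul_of_pos_right hc1 hpos
  have e2 := Nat.mul_lt_mul_of_pos_right hc2 hpos
  generalize V.ncard = a at *
  generalize V'.ncard = a' at *
  generalize W.ncard = b at *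
  generalize W'.ncard = b' at *
  zify at *
  have key1 : (0 : ℤ) ≤ (a - h) * (b - h) := mul_nonneg (by linarith) (by linarith)
  have key2 : (0 : ℤ) ≤ (a' - h) * (b' - h) := mul_nonneg (by linarith) (by linarith)
  nlinarith

/-- Unions do not decrease the quantity `|X| + |period X|` below the smaller
of its two values. -/
theorem le_ncard_union_add_card_period {C₁ C₂ : Set G} {t : ℕ}
    (h₁ : t ≤ C₁.ncard + Nat.card (period C₁)) (h₂ : t ≤ C₂.ncard + Nat.card (period C₂)) :
    t ≤ (C₁ ∪ C₂).ncard + Nat.card (period (C₁ ∪ C₂)) := by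
  by_cases h12 : C₁ ⊆ C₂
  · rwa [Set.union_eq_self_of_subset_left h12]
  by_cases h21 : C₂ ⊆ C₁
  · rwa [Set.union_eq_self_of_subset_right h21]
  obtain ⟨c₁, hc₁, hc₁'⟩ := Set.not_subset.1 h12
  obtain ⟨c₂, hc₂, hc₂'⟩ := Set.not_subset.1 h21
  have k1 := sdiff_period_bound hc₁ hc₁'
  have k2 := sdiff_period_bound hc₂ hc₂'
  rw [inf_comm] at k1
  have k3 : Nat.card (period C₁ ⊓ period C₂ : AddSubgroup G) ≤ Nat.card (period (C₁ ∪ C₂)) :=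
    Nat.card_le_card_of_injective _
      (AddSubgroup.inclusion_injective (inf_period_le_period_union C₁ C₂))
  have k4 : (C₁ ∪ C₂).ncard = C₁.ncard + (C₂ \ C₁).ncard := by
    rw [← Set.ncard_union_eq Set.disjoint_sdiff_right, Set.union_sdiff_self]
  have k5 : (C₁ ∪ C₂).ncard = C₂.ncard + (C₁ \ C₂).ncard := by
    rw [← Set.ncard_union_eq Set.disjoint_sdiff_right, Set.union_sdiff_self, Set.union_comm]
  omega

/-- A nonempty finite union of sets with `t ≤ |X| + |period X|` has the same property. -/
theorem le_ncard_sUnion_add_card_period {t : ℕ} (𝒞 : Set (Set G)) (hne : 𝒞.Nonempty)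
    (h : ∀ X ∈ 𝒞, t ≤ X.ncard + Nat.card (period X)) :
    t ≤ (⋃₀ 𝒞).ncard + Nat.card (period (⋃₀ 𝒞)) := by
  have hfin : 𝒞.Finite := Set.toFinite _
  induction 𝒞, hfin using Set.Finite.induction_on with
  | empty => exact absurd hne Set.not_nonempty_empty
  | @insert X 𝒟 _ _ ih =>
    rw [Set.sUnion_insert]
    rcases 𝒟.eq_empty_or_nonempty with rfl | hD
    · simpa using h X (by simp)
    · exact le_ncard_union_add_card_period (h X (by simp))
        (ih hD fun Y hY => h Y (Set.mem_insert_of_mem _ hY))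

end AdditiveCombinatorics

section AdditiveCombinatorics

variable {G : Type*} [AddCommGroup G] [Finite G]

theorem mem_period_of_forall {X : Set G} {g : G} (h : ∀ x ∈ X, g + x ∈ X) : g ∈ period X := by
  have himg : (fun x => g + x) '' X = X := by
    refine Set.eq_of_subset_of_ncard_le ?_ ?_ (Set.toFinite _)
    · rintro _ ⟨x, hx, rfl⟩
      exact h x hx
    · rw [Set.ncard_image_of_injective _ (add_right_injective g)]
  intro x
  refine ⟨fun hx => ?_, h x⟩
  rw [← himg] at hx
  obtain ⟨y, hy, hyx⟩ := hx
  rwa [← add_left_cancel hyx]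

theorem exists_subset_add_of_mem (m : ℕ) : ∀ (A B : Set G), B.ncard ≤ m → ∀ a ∈ A, ∀ b ∈ B,
    ∃ X ⊆ A + B, a + b ∈ X ∧ A.ncard + B.ncard ≤ X.ncard + Nat.card (period X) := by
  induction m with
  | zero =>
    intro A B hB a _ b hb
    have : 0 < B.ncard := (Set.ncard_pos (Set.toFinite _)).2 ⟨b, hb⟩
    omega
  | succ m ih =>
    intro A B hB a ha b hb
    by_cases hall : ∀ e ∈ A, ∀ b' ∈ B, e - b + b' ∈ A
    · refine ⟨(fun x => x + b) '' A, ?_, ⟨a, ha, rfl⟩, ?_⟩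
      · rintro _ ⟨x, hx, rfl⟩
        exact ⟨x, hx, b, hb, rfl⟩
      · rw [Set.ncard_image_of_injective _ (add_left_injective b)]
        refine Nat.add_le_add_left ?_ _
        rw [show Nat.card (period ((fun x => x + b) '' A))
          = ((period ((fun x => x + b) '' A) : AddSubgroup G) : Set G).ncard from
            Nat.card_coe_set_eq _]
        refine Set.ncard_le_ncard_of_injOn (fun y => y - b) ?_ ?_ (Set.toFinite _)
        · intro y hy
          refine mem_period_of_forall ?_
          rintro _ ⟨x, hx, rfl⟩
          exact ⟨x - b + y, hall x hx y hy, by dsimp only; abel⟩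
        · intro x _ y _ hxy
          simpa using hxy
    · push Not at hall
      obtain ⟨e₀, he₀, b', hb', hnot⟩ := hall
      set e := e₀ - b with he
      have heb : e + b ∈ A := by simpa [he] using he₀
      let A' : Set G := A ∪ (fun y => e + y) '' B
      let B' : Set G := {y | y ∈ B ∧ e + y ∈ A}
      have hB'B : B'.ncard < B.ncard := by
        refine Set.ncard_lt_ncard ⟨fun y hy => hy.1, fun hsub => ?_⟩ (Set.toFinite _)
        exact hnot (hsub hb').2
      have hinter : (A ∩ (fun y => e + y) '' B).ncard = B'.ncard := by
        rw [← Set.ncard_image_of_injective B' (add_right_injective e)]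
        congr 1
        ext x
        constructor
        · rintro ⟨hx, y, hy, rfl⟩
          exact ⟨y, ⟨hy, hx⟩, rfl⟩
        · rintro ⟨y, ⟨hy, hx⟩, rfl⟩
          exact ⟨hx, y, hy, rfl⟩
      have hsum : A'.ncard + B'.ncard = A.ncard + B.ncard := by
        rw [← hinter, Set.ncard_union_add_ncard_inter,
          Set.ncard_image_of_injective _ (add_right_injective e)]
      obtain ⟨X, hX, hmem, hcard⟩ :=
        ih A' B' (by omega) a (Or.inl ha) b ⟨hb, heb⟩
      refine ⟨X, hX.trans ?_, hmem, by omega⟩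
      rintro _ ⟨x, hx, y, ⟨hy, hy'⟩, rfl⟩
      rcases hx with hx | ⟨z, hz, rfl⟩
      · exact ⟨x, hx, y, hy, rfl⟩
      · exact ⟨e + y, hy', z, hz, by dsimp only; abel⟩

theorem ncard_add_ncard_le_ncard_add_add_card_period {A B : Set G} (hA : A.Nonempty)
    (hB : B.Nonempty) : A.ncard + B.ncard ≤ (A + B).ncard + Nat.card (period (A + B)) := by
  let 𝒞 : Set (Set G) := {X | X ⊆ A + B ∧ A.ncard + B.ncard ≤ X.ncard + Nat.card (period X)}
  have key : ∀ a ∈ A, ∀ b ∈ B, ∃ X ∈ 𝒞, a + b ∈ X := by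
    intro a ha b hb
    obtain ⟨X, hX, hmem, hcard⟩ := exists_subset_add_of_mem _ A B le_rfl a ha b hb
    exact ⟨X, ⟨hX, hcard⟩, hmem⟩
  have hU : ⋃₀ 𝒞 = A + B := by
    refine Set.Subset.antisymm (Set.sUnion_subset fun X hX => hX.1) ?_
    rintro _ ⟨a, ha, b, hb, rfl⟩
    exact key a ha b hb
  obtain ⟨a, ha⟩ := hA
  obtain ⟨b, hb⟩ := hB
  obtain ⟨X, hX, -⟩ := key a ha b hb
  have := le_ncard_sUnion_add_card_period 𝒞 ⟨X, hX⟩ fun X hX => hX.2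
  rwa [hU] at this

/-- **Kneser's addition theorem**. -/
theorem kneser_addition {A B : Set G} (hA : A.Nonempty) (hB : B.Nonempty) :
    (saturation (period (A + B)) A).ncard + (saturation (period (A + B)) B).ncard ≤
      (A + B).ncard + Nat.card (period (A + B)) := by
  have h := ncard_add_ncard_le_ncard_add_add_card_period
    (saturation_nonempty (K := period (A + B)).2 hA)
    (saturation_nonempty (K := period (A + B)).2 hB)
  rwa [saturation_add_saturation, saturation_eq_self le_rfl] at h

end AdditiveCombinatorics

section AdditiveCombinatorics

variable {G : Type*} [AddCommGroup G]

theorem saturation_bot (X : Set G) : saturation ⊥ X = X :=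
  saturation_eq_self bot_le

theorem period_le_of_subset_coset {X : Set G} {K : AddSubgroup G} {r : G} (hX : X.Nonempty)
    (h : ∀ x ∈ X, x - r ∈ K) : period X ≤ K := by
  obtain ⟨x, hx⟩ := hX
  intro g hg
  simpa using K.sub_mem (h _ ((hg x).2 hx)) (h x hx)

theorem le_period_cosetSlice {X : Set G} {L K : AddSubgroup G} (hX : L ≤ period X) (hLK : L ≤ K)
    (r : G) : L ≤ period (cosetSlice X K r) := by
  rw [le_period_iff]
  rintro g hg x ⟨hx, hxr⟩
  exact ⟨le_period_iff.1 hX g hg x hx, by simpa [add_sub_assoc] using K.add_mem (hLK hg) hxr⟩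

theorem le_period_union {X Y : Set G} {L : AddSubgroup G} (hX : L ≤ period X)
    (hY : L ≤ period Y) : L ≤ period (X ∪ Y) :=
  (le_inf hX hY).trans (inf_period_le_period_union X Y)

theorem le_period_inter {X Y : Set G} {L : AddSubgroup G} (hX : L ≤ period X)
    (hY : L ≤ period Y) : L ≤ period (X ∩ Y) :=
  fun _ hg x => and_congr (hX hg x) (hY hg x)

/-- Saturating a summand by the period of the sumset does not create new periods. -/
theorem period_saturation_right {A B : Set G} :
    period (saturation (period (A + B)) B) = period (A + B) := by
  refine le_antisymm ?_ (le_period_saturation _ _)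
  have h : saturation (period (A + B)) A + saturation (period (A + B)) B = A + B := by
    rw [saturation_add_saturation, saturation_eq_self le_rfl]
  conv_rhs => rw [← h]
  exact le_period_add_right le_rfl _

theorem period_saturation_left {A B : Set G} :
    period (saturation (period (A + B)) A) = period (A + B) := by
  rw [add_comm A B]; exact period_saturation_right

theorem saturation_union (L : AddSubgroup G) (X Y : Set G) :
    saturation L (X ∪ Y) = saturation L X ∪ saturation L Y := by
  ext g
  constructor
  · rintro ⟨x, hx | hx, h⟩
    · exact Or.inl ⟨x, hx, h⟩
    · exact Or.inr ⟨x, hx, h⟩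
  · rintro (⟨x, hx, h⟩ | ⟨x, hx, h⟩)
    · exact ⟨x, Or.inl hx, h⟩
    · exact ⟨x, Or.inr hx, h⟩

theorem cosetSlice_congr {X : Set G} {K : AddSubgroup G} {a b : G} (h : a - b ∈ K) :
    cosetSlice X K a = cosetSlice X K b := by
  ext g
  have : g - a ∈ K ↔ g - b ∈ K := by
    rw [← sub_add_sub_cancel g a b, K.add_mem_cancel_right h]
  exact and_congr_right fun _ => this

section Sums

variable {ι : Type*}

/-- All sums of `ℓ` elements chosen from `ℓ` distinct sets of the family `F` indexed by `s`. -/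
def setSums (F : ι → Set G) (s : Finset ι) (ℓ : ℕ) : Set G :=
  {g | ∃ I ⊆ s, I.card = ℓ ∧ ∃ a : ι → G, (∀ i ∈ I, a i ∈ F i) ∧ ∑ i ∈ I, a i = g}

theorem setSums_zero (F : ι → Set G) (s : Finset ι) : setSums F s 0 = {0} := by
  ext g
  constructor
  · rintro ⟨I, -, hI, a, -, rfl⟩
    rw [Finset.card_eq_zero.1 hI]
    simp
  · rintro rfl
    exact ⟨∅, by simp, rfl, 0, by simp, by simp⟩

theorem setSums_mono {F : ι → Set G} {s t : Finset ι} (h : s ⊆ t) (ℓ : ℕ) :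
    setSums F s ℓ ⊆ setSums F t ℓ := by
  rintro g ⟨I, hI, h'⟩
  exact ⟨I, hI.trans h, h'⟩

theorem setSums_congr {F F' : ι → Set G} {s : Finset ι} (h : ∀ i ∈ s, F i = F' i) (ℓ : ℕ) :
    setSums F s ℓ = setSums F' s ℓ := by
  ext g
  constructor
  · rintro ⟨I, hI, hc, a, ha, h'⟩
    exact ⟨I, hI, hc, a, fun i hi => h i (hI hi) ▸ ha i hi, h'⟩
  · rintro ⟨I, hI, hc, a, ha, h'⟩
    exact ⟨I, hI, hc, a, fun i hi => (h i (hI hi)).symm ▸ ha i hi, h'⟩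

theorem add_mem_setSums_insert [DecidableEq ι] {F : ι → Set G} {s : Finset ι} {i : ι}
    (hi : i ∉ s) {ℓ : ℕ} {x g : G} (hx : x ∈ F i) (hg : g ∈ setSums F s ℓ) :
    x + g ∈ setSums F (insert i s) (ℓ + 1) := by
  obtain ⟨I, hI, hc, a, ha, rfl⟩ := hg
  have hiI : i ∉ I := fun h => hi (hI h)
  refine ⟨insert i I, Finset.insert_subset_insert i hI,
    by rw [Finset.card_insert_of_notMem hiI, hc],
    Function.update a i x, ?_, ?_⟩
  · intro j hj
    rcases Finset.mem_insert.1 hj with rfl | hjI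
    · simpa using hx
    · rw [Function.update_of_ne (by rintro rfl; exact hiI hjI)]
      exact ha j hjI
  · rw [Finset.sum_insert hiI, Function.update_self]
    congr 1
    refine Finset.sum_congr rfl fun j hj => ?_
    rw [Function.update_of_ne (by rintro rfl; exact hiI hj)]

theorem mem_setSums_insert [DecidableEq ι] {F : ι → Set G} {s : Finset ι} {i : ι} (hi : i ∉ s)
    {ℓ : ℕ} {g : G} : g ∈ setSums F (insert i s) (ℓ + 1) ↔
      g ∈ setSums F s (ℓ + 1) ∨ ∃ x ∈ F i, ∃ d ∈ setSums F s ℓ, g = x + d := by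
  constructor
  · rintro ⟨I, hI, hc, a, ha, rfl⟩
    by_cases hiI : i ∈ I
    · right
      refine ⟨a i, ha i hiI, ∑ j ∈ I.erase i, a j, ⟨I.erase i, ?_, ?_, a, ?_, rfl⟩, ?_⟩
      · intro j hj
        exact (Finset.mem_insert.1 (hI (Finset.mem_of_mem_erase hj))).resolve_left
          (Finset.ne_of_mem_erase hj)
      · rw [Finset.card_erase_of_mem hiI, hc]; rfl
      · exact fun j hj => ha j (Finset.mem_of_mem_erase hj)
      · rw [Finset.add_sum_erase _ _ hiI]
    · left
      refine ⟨I, fun j hj => (Finset.mem_insert.1 (hI hj)).resolve_left ?_, hc, a, ha, rfl⟩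
      rintro rfl
      exact hiI hj
  · rintro (h | ⟨x, hx, d, hd, rfl⟩)
    · exact setSums_mono (Finset.subset_insert i s) _ h
    · exact add_mem_setSums_insert hi hx hd

theorem le_period_setSums {F : ι → Set G} {L : AddSubgroup G} (hF : ∀ i, L ≤ period (F i))
    (s : Finset ι) (ℓ : ℕ) : L ≤ period (setSums F s (ℓ + 1)) := by
  classical
  rw [le_period_iff]
  rintro g hg _ ⟨I, hI, hc, a, ha, rfl⟩
  obtain ⟨i, hi⟩ : I.Nonempty := by rw [← Finset.card_pos]; omega
  refine ⟨I, hI, hc, Function.update a i (g + a i), ?_, ?_⟩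
  · intro j hj
    rcases eq_or_ne j i with rfl | hji
    · simpa using le_period_iff.1 (hF j) g hg _ (ha j hj)
    · rw [Function.update_of_ne hji]; exact ha j hj
  · rw [Finset.sum_update_of_mem hi, ← Finset.add_sum_erase _ _ hi, add_assoc,
      Finset.sdiff_singleton_eq_erase]

theorem setSums_saturation {K : AddSubgroup G} (F : ι → Set G) (s : Finset ι) (ℓ : ℕ) :
    saturation K (setSums (fun i => saturation K (F i)) s ℓ) = saturation K (setSums F s ℓ) := by
  refine Set.Subset.antisymm ?_ (saturation_mono le_rfl ?_)
  · rintro g ⟨_, ⟨I, hI, hc, a, ha, rfl⟩, hg⟩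
    choose! b hb hab using ha
    refine ⟨∑ i ∈ I, b i, ⟨I, hI, hc, b, hb, rfl⟩, ?_⟩
    have := K.add_mem hg (K.sum_mem hab)
    rwa [Finset.sum_sub_distrib, sub_add_sub_cancel] at this
  · rintro g ⟨I, hI, hc, a, ha, h⟩
    exact ⟨I, hI, hc, a, fun i hi => subset_saturation _ _ (ha i hi), h⟩

open Classical in
/-- The number of sets of the family `F` on `s` meeting the coset `g + K`. -/
noncomputable def cosetHits (F : ι → Set G) (s : Finset ι) (K : AddSubgroup G) (g : G) : ℕ :=
  (s.filter fun i => g ∈ saturation K (F i)).card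

open Classical in
theorem cosetHits_insert [DecidableEq ι] {F : ι → Set G} {s : Finset ι} {i : ι} (hi : i ∉ s)
    (K : AddSubgroup G) (g : G) :
    cosetHits F (insert i s) K g =
      cosetHits F s K g + if g ∈ saturation K (F i) then 1 else 0 := by
  unfold cosetHits
  rw [Finset.filter_insert]
  split_ifs with h
  · rw [Finset.card_insert_of_notMem (by simp [hi])]
  · simp

theorem cosetHits_congr {F F' : ι → Set G} {s : Finset ι} (h : ∀ i ∈ s, F i = F' i)
    (K : AddSubgroup G) (g : G) : cosetHits F s K g = cosetHits F' s K g := by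
  classical
  unfold cosetHits
  congr 1
  refine Finset.filter_congr fun i hi => ?_
  rw [h i hi]

theorem cosetHits_mono (F : ι → Set G) (s : Finset ι) {K L : AddSubgroup G} (h : K ≤ L) (g : G) :
    cosetHits F s K g ≤ cosetHits F s L g := by
  classical
  refine Finset.card_le_card fun i hi => ?_
  rw [Finset.mem_filter] at hi ⊢
  exact ⟨hi.1, saturation_mono h le_rfl hi.2⟩

theorem cosetHits_saturation (F : ι → Set G) (s : Finset ι) {K L : AddSubgroup G} (h : K ≤ L)
    (g : G) : cosetHits (fun i => saturation K (F i)) s L g = cosetHits F s L g := by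
  classical
  unfold cosetHits
  simp only [saturation_saturation h]

theorem cosetHits_le_card {F : ι → Set G} {s J : Finset ι} {K : AddSubgroup G} {g : G}
    (h : ∀ i ∈ s, i ∉ J → g ∉ saturation K (F i)) : cosetHits F s K g ≤ J.card := by
  classical
  refine Finset.card_le_card fun i hi => ?_
  rw [Finset.mem_filter] at hi
  by_contra hJ
  exact h i hi.1 hJ hi.2

variable [Fintype G]

/-- The total number of coset hits, truncated at `ℓ` for each point. -/
noncomputable def truncatedHits (F : ι → Set G) (s : Finset ι) (K : AddSubgroup G) (ℓ : ℕ) : ℕ :=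
  ∑ g : G, min ℓ (cosetHits F s K g)

end Sums

open Classical in
theorem sum_ite_mem_eq_ncard {α : Type*} [Fintype α] (X : Set α) :
    ∑ g : α, (if g ∈ X then 1 else 0) = X.ncard := by
  rw [Finset.sum_boole, Set.ncard_eq_toFinset_card']
  simp

theorem ncard_coset (K : AddSubgroup G) (r : G) : {g : G | g - r ∈ K}.ncard = Nat.card K := by
  rw [show Nat.card K = (K : Set G).ncard from Nat.card_coe_set_eq _,
    ← Set.ncard_image_of_injective (K : Set G) (add_left_injective r)]
  congr 1
  ext g
  constructor
  · intro hg
    exact ⟨g - r, hg, by simp⟩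
  · rintro ⟨k, hk, rfl⟩
    simpa using hk

theorem saturation_cosetSlice_subset {X : Set G} {L K : AddSubgroup G} (h : L ≤ K) {r g : G}
    (hg : g ∈ saturation L (cosetSlice X K r)) : g - r ∈ K := by
  obtain ⟨x, ⟨-, hx⟩, hgx⟩ := hg
  simpa using K.add_mem (h hgx) hx

theorem mem_saturation_cosetSlice {X : Set G} {L K : AddSubgroup G} (h : L ≤ K) {r g : G}
    (hg : g ∈ saturation L X) (hr : g - r ∈ K) : g ∈ saturation L (cosetSlice X K r) := by
  obtain ⟨x, hx, hgx⟩ := hg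
  refine ⟨x, ⟨hx, ?_⟩, hgx⟩
  simpa using K.sub_mem hr (h hgx)

theorem card_add_ncard_saturation_le [Finite G] {X : Set G} {L K : AddSubgroup G} (h : L ≤ K)
    {a : G} (ha : a ∈ X) :
    Nat.card K + (saturation L X).ncard ≤
      (saturation L (cosetSlice X K a)).ncard + (saturation K X).ncard := by
  rw [← ncard_coset K a, ← Set.ncard_union_add_ncard_inter, add_comm]
  refine add_le_add (Set.ncard_le_ncard ?_ (Set.toFinite _))
    (Set.ncard_le_ncard ?_ (Set.toFinite _))
  · rintro g ⟨hg, hg'⟩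
    exact mem_saturation_cosetSlice h hg' hg
  · rintro g (hg | hg)
    · exact ⟨a, ha, hg⟩
    · exact saturation_mono h le_rfl hg

end AdditiveCombinatorics

section AdditiveCombinatorics

variable {G : Type*} [AddCommGroup G] [Finite G]

/-- Two subsets of cosets of `K` with more than `|K|` elements in total have a full coset as
their sumset. -/
theorem mem_add_of_card_lt {K : AddSubgroup G} {X Y : Set G} {a b z : G}
    (hX : ∀ x ∈ X, x - a ∈ K) (hY : ∀ y ∈ Y, y - b ∈ K) (hz : z - (a + b) ∈ K)
    (hcard : Nat.card K < X.ncard + Y.ncard) : z ∈ X + Y := by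
  by_contra hnot
  have hdisj : Disjoint X ((fun y => z - y) '' Y) := by
    rw [Set.disjoint_left]
    rintro _ hx ⟨y, hy, rfl⟩
    exact hnot ⟨z - y, hx, y, hy, by simp⟩
  have hle : (X ∪ (fun y => z - y) '' Y).ncard ≤ Nat.card K := by
    rw [← ncard_coset K a]
    refine Set.ncard_le_ncard ?_ (Set.toFinite _)
    rintro g (hg | ⟨y, hy, rfl⟩)
    · exact hX g hg
    · have := K.sub_mem hz (hY y hy)
      have h' : z - (a + b) - (y - b) = z - y - a := by abel
      rwa [h'] at this
  rw [Set.ncard_union_eq hdisj, Set.ncard_image_of_injective _ sub_right_injective] at hle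
  omega

theorem ncard_saturation_add_le {L : AddSubgroup G} {X Y : Set G} (hX : X.Nonempty)
    (hY : Y.Nonempty) : (saturation L X).ncard + (saturation L Y).ncard ≤
      (saturation L (X + Y)).ncard + Nat.card (period (saturation L (X + Y))) := by
  have h := ncard_add_ncard_le_ncard_add_add_card_period
    (saturation_nonempty (K := L).2 hX) (saturation_nonempty (K := L).2 hY)
  rwa [saturation_add_saturation] at h

/-- The sums of an element of `X` and an element of `Y`, one of them in `a + K` and the other
in `b + K`. -/
def crossSums (X Y : Set G) (K : AddSubgroup G) (a b : G) : Set G :=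
  (cosetSlice X K a + cosetSlice Y K b) ∪ (cosetSlice X K b + cosetSlice Y K a)

theorem ncard_saturation_union_slice_le {X Y : Set G} {L K : AddSubgroup G} (hLK : L ≤ K) (a : G) :
    (saturation L (X ∪ Y) ∩ {g | g - a ∈ K}).ncard ≤
      (saturation L (cosetSlice X K a)).ncard + (saturation L (cosetSlice Y K a)).ncard := by
  refine le_trans (Set.ncard_le_ncard ?_ (Set.toFinite _)) (Set.ncard_union_le _ _)
  rintro g ⟨hg, hga⟩
  rw [saturation_union] at hg
  exact hg.imp (mem_saturation_cosetSlice hLK · hga) (mem_saturation_cosetSlice hLK · hga)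

theorem ncard_saturation_union_add_card_le {X Y : Set G} {L K : AddSubgroup G} (hLK : L ≤ K)
    {a b : G} (ha : a ∈ X) (hb : b ∈ Y)
    (hper : period (saturation L (crossSums X Y K a b)) = L)
    (hfull : ∃ z, z - (a + b) ∈ K ∧ z ∉ saturation L (crossSums X Y K a b)) :
    (saturation L (X ∪ Y) ∩ {g | g - a ∈ K ∨ g - b ∈ K}).ncard + Nat.card K ≤
      (saturation L (crossSums X Y K a b)).ncard + Nat.card L +
        {g : G | g - a ∈ K ∨ g - b ∈ K}.ncard := by
  obtain ⟨z, hzK, hz⟩ := hfull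
  have hXa : (cosetSlice X K a).Nonempty := ⟨a, ha, by simp⟩
  have hYb : (cosetSlice Y K b).Nonempty := ⟨b, hb, by simp⟩
  have hkn := ncard_saturation_add_le (L := L) hXa hYb
  by_cases hab : a - b ∈ K
  · have hcross : crossSums X Y K a b = cosetSlice X K a + cosetSlice Y K b := by
      rw [crossSums, cosetSlice_congr (X := X) hab, cosetSlice_congr (X := Y) hab, Set.union_self]
    have hset : {g : G | g - a ∈ K ∨ g - b ∈ K} = {g | g - a ∈ K} := by
      ext g
      have : g - a ∈ K ↔ g - b ∈ K := by
        rw [← sub_add_sub_cancel g a b, K.add_mem_cancel_right hab]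
      simp [this]
    rw [hset, ncard_coset]
    have h1 := ncard_saturation_union_slice_le (X := X) (Y := Y) hLK a
    rw [cosetSlice_congr (X := Y) hab] at h1
    rw [← hcross, hper] at hkn
    omega
  · have hdisj : Disjoint {g : G | g - a ∈ K} {g : G | g - b ∈ K} := by
      rw [Set.disjoint_left]
      intro g hga hgb
      exact hab (by simpa using K.sub_mem hgb hga)
    have hset : {g : G | g - a ∈ K ∨ g - b ∈ K} = {g | g - a ∈ K} ∪ {g | g - b ∈ K} := rfl
    rw [hset, Set.ncard_union_eq hdisj, ncard_coset, ncard_coset, Set.inter_union_distrib_left]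
    have h0 := Set.ncard_union_le (saturation L (X ∪ Y) ∩ {g | g - a ∈ K})
      (saturation L (X ∪ Y) ∩ {g | g - b ∈ K})
    have h1 := ncard_saturation_union_slice_le (X := X) (Y := Y) hLK a
    have h2 := ncard_saturation_union_slice_le (X := X) (Y := Y) hLK b
    have hz' := hz
    rw [crossSums, saturation_union] at hz'
    have hle₁ : (saturation L (cosetSlice X K a)).ncard +
        (saturation L (cosetSlice Y K b)).ncard ≤ Nat.card K := by
      by_contra hlt
      refine hz' (Or.inl ?_)
      rw [← saturation_add_saturation]
      exact mem_add_of_card_lt (fun x hx => saturation_cosetSlice_subset hLK hx)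
        (fun x hx => saturation_cosetSlice_subset hLK hx) hzK (not_le.1 hlt)
    have hle₂ : (saturation L (cosetSlice X K b)).ncard +
        (saturation L (cosetSlice Y K a)).ncard ≤ Nat.card K := by
      by_contra hlt
      refine hz' (Or.inr ?_)
      rw [← saturation_add_saturation]
      exact mem_add_of_card_lt (fun x hx => saturation_cosetSlice_subset hLK hx)
        (fun x hx => saturation_cosetSlice_subset hLK hx) (by rwa [add_comm]) (not_le.1 hlt)
    rcases (cosetSlice X K b + cosetSlice Y K a).eq_empty_or_nonempty with
      hemp | ⟨_, x, hx, y, hy, _⟩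
    · have hcross : crossSums X Y K a b = cosetSlice X K a + cosetSlice Y K b := by
        rw [crossSums, hemp, Set.union_empty]
      rw [← hcross, hper] at hkn
      omega
    · have hkn' := ncard_saturation_add_le (L := L) ⟨x, hx⟩ ⟨y, hy⟩
      have hun := le_ncard_union_add_card_period
        (min_le_left _ _ |>.trans hkn) (min_le_right _ _ |>.trans hkn')
      rw [← saturation_union, ← crossSums, hper] at hun
      omega

end AdditiveCombinatorics

section AdditiveCombinatorics

variable {G : Type*} [AddCommGroup G]

/-- Descent on the period: a property of pairs `(E, H)` that can always be pushed to a smaller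
subgroup as long as `H` is not the period of `T` eventually holds with `H = period T`. -/
theorem exists_of_period_descent [Finite G] {T : Set G} {P : Set G → AddSubgroup G → Prop}
    (hP : ∀ E H, P E H → period T ≤ H)
    (step : ∀ E H, P E H → ∀ c ∈ T, ∀ x ∉ T, x - c ∈ H → ∃ E' H', P E' H' ∧ H' < H)
    {E : Set G} {H : AddSubgroup G} (h : P E H) : ∃ E', P E' (period T) := by
  induction H using WellFoundedLT.induction generalizing E with
  | ind H ih =>
    rcases (hP E H h).eq_or_lt with heq | hlt
    · exact ⟨E, heq ▸ h⟩
    · obtain ⟨g, hgH, hgT⟩ := SetLike.exists_of_lt hlt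
      have : ∃ c ∈ T, g + c ∉ T := by
        by_contra hcon
        push Not at hcon
        exact hgT (mem_period_of_forall hcon)
      obtain ⟨c, hc, hgc⟩ := this
      obtain ⟨E', H', hE', hH'⟩ := step E H h c hc _ hgc (by simpa using hgH)
      exact ih H' hH' hE'

variable [Fintype G] {ι : Type*}

/-- The lower bound for the size of a set `E` of `ℓ`-term sums inside a coset of `K`,
relative to a subgroup `H`. -/
def SliceBound (F : ι → Set G) (s : Finset ι) (ℓ : ℕ) (K : AddSubgroup G) (E : Set G)
    (H : AddSubgroup G) : Prop :=
  ℓ * Nat.card K + Nat.card H + truncatedHits F s H ℓ ≤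
    E.ncard + truncatedHits F s K ℓ + ℓ * Nat.card H

/-- The lower bound for the part of the `ℓ`-term sums in the coset `r + K`, modulo `M`. -/
def SliceStatement (F : ι → Set G) (s : Finset ι) (ℓ : ℕ) (M K : AddSubgroup G) (r : G) : Prop :=
  M ≤ K → (cosetSlice (setSums F s ℓ) K r).Nonempty →
    SliceBound F s ℓ K (saturation M (cosetSlice (setSums F s ℓ) K r))
      (period (saturation M (cosetSlice (setSums F s ℓ) K r)))

theorem sliceStatement_zero (F : ι → Set G) (s : Finset ι) (M K : AddSubgroup G) (r : G) :
    SliceStatement F s 0 M K r := by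
  rintro hMK ⟨x, hx, hxr⟩
  have h0 := card_le_ncard_of_le_period (K := period
      (saturation M (cosetSlice (setSums F s 0) K r))) le_rfl
      (saturation_nonempty.2 ⟨x, hx, hxr⟩)
  simpa [SliceBound, truncatedHits] using h0

/-- In a family where the sets outside a fixed `ℓ`-element choice lie in `F i`, removing `F i`
lowers the truncated hits by exactly the size of `F i`. -/
theorem truncatedHits_insert_of_subset [DecidableEq ι] {F : ι → Set G} {s J : Finset ι} {i : ι}
    (hi : i ∉ s) (hJ : ∀ o ∈ s, o ∉ J → F o ⊆ F i) (K : AddSubgroup G) :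
    truncatedHits F (insert i s) K (J.card + 1) =
      truncatedHits F s K J.card + (saturation K (F i)).ncard := by
  classical
  rw [← sum_ite_mem_eq_ncard, truncatedHits, truncatedHits, ← Finset.sum_add_distrib]
  refine Finset.sum_congr rfl fun g _ => ?_
  rw [cosetHits_insert hi]
  split_ifs with hg
  · omega
  · have : cosetHits F s K g ≤ J.card :=
      cosetHits_le_card fun o ho hoJ hgo => hg (saturation_mono le_rfl (hJ o ho hoJ) hgo)
    omega

/-- Every `ℓ + 1`-term sum either uses a set incomparable to an unused one, or uses a set
containing all unused ones. -/
theorem setSums_incomparable_or_dominating [DecidableEq ι] {F : ι → Set G} {s : Finset ι} {m : ℕ}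
    {c : G} (hc : c ∈ setSums F s (m + 1)) :
    (∃ i k, ∃ t : Finset ι, i ≠ k ∧ i ∉ t ∧ k ∉ t ∧ s = insert i (insert k t) ∧
      ¬ F i ⊆ F k ∧ ¬ F k ⊆ F i ∧ ∃ x ∈ F i, ∃ d ∈ setSums F t m, c = x + d) ∨
    (∃ i, ∃ t J : Finset ι, i ∉ t ∧ s = insert i t ∧ J.card = m ∧
      (∀ o ∈ t, o ∉ J → F o ⊆ F i) ∧ ∃ x ∈ F i, ∃ d ∈ setSums F t m, c = x + d) := by
  classical
  let R : Finset (Finset ι) := s.powerset.filter fun I =>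
    I.card = m + 1 ∧ ∃ a : ι → G, (∀ i ∈ I, a i ∈ F i) ∧ ∑ i ∈ I, a i = c
  have hR : ∀ I, I ∈ R ↔ I ⊆ s ∧ I.card = m + 1 ∧
      ∃ a : ι → G, (∀ i ∈ I, a i ∈ F i) ∧ ∑ i ∈ I, a i = c := by
    intro I
    simp only [R, Finset.mem_filter, Finset.mem_powerset]
  obtain ⟨I₀, hI₀, hcard₀, a₀, ha₀, hsum₀⟩ := hc
  obtain ⟨I, hI, hmax⟩ := Finset.exists_max_image R (fun I => ∑ i ∈ I, (F i).ncard)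
    ⟨I₀, (hR _).2 ⟨hI₀, hcard₀, a₀, ha₀, hsum₀⟩⟩
  obtain ⟨hIs, hcard, a, ha, hsum⟩ := (hR I).1 hI
  obtain ⟨i, hi⟩ : I.Nonempty := by rw [← Finset.card_pos]; omega
  by_cases hall : ∀ i ∈ I, ∀ k ∈ s, k ∉ I → F k ⊆ F i
  · right
    refine ⟨i, s.erase i, I.erase i, Finset.notMem_erase i s, (Finset.insert_erase (hIs hi)).symm,
      by rw [Finset.card_erase_of_mem hi, hcard]; rfl, ?_, a i, ha i hi, ∑ j ∈ I.erase i, a j,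
      ⟨I.erase i, Finset.erase_subset_erase i hIs,
        by rw [Finset.card_erase_of_mem hi, hcard]; rfl, a,
        fun j hj => ha j (Finset.mem_of_mem_erase hj), rfl⟩, ?_⟩
    · intro o ho hoJ
      refine hall i hi o (Finset.mem_of_mem_erase ho) fun hoI => hoJ ?_
      exact Finset.mem_erase.2 ⟨Finset.ne_of_mem_erase ho, hoI⟩
    · rw [Finset.add_sum_erase _ _ hi, hsum]
  · left
    push Not at hall
    obtain ⟨i, hi, k, hk, hkI, hnot⟩ := hall
    have hik : i ≠ k := by rintro rfl; exact hkI hi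
    refine ⟨i, k, (s.erase i).erase k, hik, by simp, by simp, ?_, ?_, hnot, a i, ha i hi,
      ∑ j ∈ I.erase i, a j, ⟨I.erase i, ?_, ?_, a, ?_, rfl⟩, ?_⟩
    · rw [Finset.insert_erase (Finset.mem_erase.2 ⟨hik.symm, hk⟩), Finset.insert_erase (hIs hi)]
    · intro hsub
      have hkI' : k ∉ I.erase i := fun h => hkI (Finset.mem_of_mem_erase h)
      have hmem : insert k (I.erase i) ∈ R := by
        rw [hR]
        refine ⟨Finset.insert_subset hk ((Finset.erase_subset _ _).trans hIs), ?_,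
          Function.update a k (a i), ?_, ?_⟩
        · rw [Finset.card_insert_of_notMem hkI', Finset.card_erase_of_mem hi, hcard]; rfl
        · intro j hj
          rcases Finset.mem_insert.1 hj with rfl | hj'
          · simpa using hsub (ha i hi)
          · rw [Function.update_of_ne (by rintro rfl; exact hkI' hj')]
            exact ha j (Finset.mem_of_mem_erase hj')
        · rw [Finset.sum_insert hkI', Function.update_self, ← hsum, ← Finset.add_sum_erase I a hi]
          congr 1
          refine Finset.sum_congr rfl fun j hj => ?_
          rw [Function.update_of_ne (by rintro rfl; exact hkI' hj)]
      have hlt : (F i).ncard < (F k).ncard :=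
        Set.ncard_lt_ncard ⟨hsub, hnot⟩ (Set.toFinite _)
      have hle := hmax _ hmem
      rw [Finset.sum_insert hkI', ← Finset.add_sum_erase I (fun i => (F i).ncard) hi] at hle
      omega
    · intro j hj
      refine Finset.mem_erase.2 ⟨?_, Finset.erase_subset_erase i hIs hj⟩
      rintro rfl
      exact hkI (Finset.mem_of_mem_erase hj)
    · rw [Finset.card_erase_of_mem hi, hcard]; rfl
    · exact fun j hj => ha j (Finset.mem_of_mem_erase hj)
    · rw [Finset.add_sum_erase _ _ hi, hsum]

end AdditiveCombinatorics

section AdditiveCombinatorics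

variable {G : Type*} [AddCommGroup G] [Fintype G] {ι : Type*}

/-- The case of the slice bound in which one used set contains all unused sets. -/
theorem sliceBound_of_dominating [DecidableEq ι] {F : ι → Set G} {s t J : Finset ι} {m : ℕ}
    {K : AddSubgroup G} {r c : G} {i : ι}
    (ihℓ : ∀ (s : Finset ι) (M K : AddSubgroup G) (r : G), SliceStatement F s m M K r)
    (ihK : ∀ (K' : AddSubgroup G), K' < K → ∀ (M : AddSubgroup G) (r : G),
      SliceStatement F s (m + 1) M K' r)
    (hper : ∀ i, period (cosetSlice (setSums F s (m + 1)) K r) ≤ period (F i))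
    (hcr : c - r ∈ K) (hit : i ∉ t) (hs : s = insert i t) (hJ : J.card = m)
    (hdom : ∀ o ∈ t, o ∉ J → F o ⊆ F i) {x d : G} (hx : x ∈ F i) (hd : d ∈ setSums F t m)
    (hc : c = x + d) :
    SliceBound F s (m + 1) K (cosetSlice (setSums F s (m + 1)) K r)
      (period (cosetSlice (setSums F s (m + 1)) K r)) := by
  set T := cosetSlice (setSums F s (m + 1)) K r with hT
  have hxd : x + d ∈ T := ⟨by rw [hs]; exact add_mem_setSums_insert hit hx hd, by rwa [hc] at hcr⟩
  have hTK : period T ≤ K := period_le_of_subset_coset ⟨_, hxd⟩ fun y hy => hy.2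
  let P : Set G → AddSubgroup G → Prop := fun E H =>
    E ⊆ T ∧ E.Nonempty ∧ period T ≤ H ∧ H ≤ K ∧ H ≤ period E ∧ SliceBound F s (m + 1) K E H
  suffices hstart : ∃ E H, P E H by
    obtain ⟨E, H, hEH⟩ := hstart
    have hstep : ∀ E H, P E H → ∀ c ∈ T, ∀ x ∉ T, x - c ∈ H → ∃ E' H', P E' H' ∧ H' < H := by
      rintro E H ⟨hET, hEne, hTH, hHK, hHE, hb⟩ c' hc' y hy hyc'
      have hdisj : ∀ z ∈ E, z - c' ∉ H := by
        intro z hz hzc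
        refine hy (hET (mem_of_le_period hHE hz ?_))
        simpa using H.sub_mem hyc' hzc
      have hlt : H < K := by
        refine lt_of_le_of_ne hHK ?_
        rintro rfl
        obtain ⟨z, hz⟩ := hEne
        exact hdisj z hz (by simpa using H.sub_mem (hET hz).2 hc'.2)
      have hne : (cosetSlice (setSums F s (m + 1)) H c').Nonempty := ⟨c', hc'.1, by simp⟩
      have hb' := ihK H hlt ⊥ c' bot_le hne
      rw [saturation_bot] at hb'
      set D := cosetSlice (setSums F s (m + 1)) H c' with hD
      have hDT : D ⊆ T := by
        rintro z ⟨hz, hzc⟩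
        exact ⟨hz, by simpa using K.add_mem (hHK hzc) hc'.2⟩
      have hDeq : D = cosetSlice T H c' :=
        Set.Subset.antisymm (fun z hz => ⟨hDT hz, hz.2⟩) fun z hz => ⟨hz.1.1, hz.2⟩
      have hLD : period T ≤ period D := by
        rw [hDeq]; exact le_period_cosetSlice le_rfl hTH c'
      have hDH : period D ≤ H := period_le_of_subset_coset hne fun z hz => hz.2
      refine ⟨E ∪ D, period D, ⟨Set.union_subset hET hDT, hEne.mono Set.subset_union_left, hLD,
        hDH.trans hHK, le_period_union (hDH.trans hHE) le_rfl, ?_⟩, lt_of_le_of_ne hDH ?_⟩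
      · unfold SliceBound at hb hb' ⊢
        rw [Set.ncard_union_eq (Set.disjoint_left.2 fun z hz hzD => hdisj z hz hzD.2)]
        omega
      · intro heq
        have hcD : c' ∈ D := ⟨hc'.1, by simp⟩
        exact hy (hDT (mem_of_le_period heq.ge hcD hyc'))
    obtain ⟨E', hE', -, -, -, -, hb⟩ :=
      exists_of_period_descent (fun E H h => h.2.2.1) hstep hEH
    exact hb.trans (by
      have := Set.ncard_le_ncard hE' (Set.toFinite _)
      omega)
  let B := cosetSlice (F i) K x
  let Z := cosetSlice (setSums F t m) K (r - x)
  have hxB : x ∈ B := ⟨hx, by simp⟩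
  have hdZ : d ∈ Z := ⟨hd, by
    have h : d - (r - x) = c - r := by rw [hc]; abel
    rwa [h]⟩
  have hBZ : B + Z ⊆ T := by
    rintro _ ⟨b, hb, z, hz, rfl⟩
    refine ⟨by rw [hs]; exact add_mem_setSums_insert hit hb.1 hz.1, ?_⟩
    have := K.add_mem hb.2 hz.2
    have h : b - x + (z - (r - x)) = b + z - r := by abel
    rwa [h] at this
  have hne : (B + Z).Nonempty := ⟨_, x, hxB, d, hdZ, rfl⟩
  have hHK : period (B + Z) ≤ K := period_le_of_subset_coset hne fun y hy => (hBZ hy).2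
  refine ⟨B + Z, period (B + Z), hBZ, hne,
    le_period_add_left (le_period_cosetSlice (hper i) hTK x) Z, hHK, le_rfl, ?_⟩
  have hkn := kneser_addition ⟨x, hxB⟩ ⟨d, hdZ⟩
  have hind := ihℓ t (period (B + Z)) K (r - x) hHK ⟨d, hdZ⟩
  change SliceBound F t m K (saturation (period (B + Z)) Z)
    (period (saturation (period (B + Z)) Z)) at hind
  rw [period_saturation_right] at hind
  have hslice := card_add_ncard_saturation_le hHK hx
  change _ ≤ (saturation (period (B + Z)) B).ncard + _ at hslice
  unfold SliceBound at hind ⊢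
  subst hJ
  rw [hs, truncatedHits_insert_of_subset hit hdom, truncatedHits_insert_of_subset hit hdom]
  rw [add_mul, add_mul]
  omega

end AdditiveCombinatorics

section AdditiveCombinatorics

variable {G : Type*} [AddCommGroup G] {ι : Type*} [DecidableEq ι]

/-- The family obtained from `F` by replacing `F i`, `F k` by their union and intersection. -/
def uncross {α : Type*} (F : ι → Set α) (i k : ι) : ι → Set α :=
  Function.update (Function.update F i (F i ∪ F k)) k (F i ∩ F k)

theorem uncross_left {α : Type*} (F : ι → Set α) {i k : ι} (hik : i ≠ k) :
    uncross F i k i = F i ∪ F k := by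
  simp [uncross, Function.update_of_ne hik]

theorem uncross_right {α : Type*} (F : ι → Set α) (i k : ι) : uncross F i k k = F i ∩ F k := by
  simp [uncross]

theorem uncross_of_ne {α : Type*} (F : ι → Set α) {i k j : ι} (hi : j ≠ i) (hk : j ≠ k) :
    uncross F i k j = F j := by
  simp [uncross, Function.update_of_ne hi, Function.update_of_ne hk]

theorem uncross_of_notMem {α : Type*} (F : ι → Set α) {i k : ι} {t : Finset ι} (hi : i ∉ t)
    (hk : k ∉ t) :
    ∀ j ∈ t, uncross F i k j = F j :=
  fun _ hj => uncross_of_ne F (fun h => hi (h ▸ hj)) fun h => hk (h ▸ hj)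

theorem le_period_uncross {F : ι → Set G} {L : AddSubgroup G} (h : ∀ i, L ≤ period (F i))
    {i k : ι} (hik : i ≠ k) (j : ι) : L ≤ period (uncross F i k j) := by
  rcases eq_or_ne j i with rfl | hi
  · rw [uncross_left F hik]; exact le_period_union (h j) (h k)
  rcases eq_or_ne j k with rfl | hk
  · rw [uncross_right]; exact le_period_inter (h i) (h j)
  · rw [uncross_of_ne F hi hk]; exact h j

section Pairs

variable {F : ι → Set G} {t : Finset ι} {i k : ι}

theorem add_mem_setSums_pair_left (hik : i ≠ k) (hi : i ∉ t) {m : ℕ} {x d : G} (hx : x ∈ F i)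
    (hd : d ∈ setSums F t m) : x + d ∈ setSums F (insert i (insert k t)) (m + 1) :=
  add_mem_setSums_insert (by simp [hik, hi]) hx (setSums_mono (Finset.subset_insert k t) _ hd)

theorem add_mem_setSums_pair_right (hk : k ∉ t) {m : ℕ} {y d : G} (hy : y ∈ F k)
    (hd : d ∈ setSums F t m) : y + d ∈ setSums F (insert i (insert k t)) (m + 1) :=
  setSums_mono (Finset.subset_insert i _) _ (add_mem_setSums_insert hk hy hd)

theorem add_add_mem_setSums_pair (hik : i ≠ k) (hi : i ∉ t) (hk : k ∉ t) {m : ℕ} {x y d : G}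
    (hx : x ∈ F i) (hy : y ∈ F k) (hd : d ∈ setSums F t m) :
    x + (y + d) ∈ setSums F (insert i (insert k t)) (m + 1 + 1) :=
  add_mem_setSums_insert (by simp [hik, hi]) hx (add_mem_setSums_insert hk hy hd)

theorem mem_setSums_pair (hik : i ≠ k) (hi : i ∉ t) (hk : k ∉ t) {m : ℕ} {g : G}
    (hg : g ∈ setSums F (insert i (insert k t)) (m + 1)) :
    g ∈ setSums F t (m + 1) ∨ (∃ x ∈ F i, ∃ d ∈ setSums F t m, g = x + d) ∨
      (∃ y ∈ F k, ∃ d ∈ setSums F t m, g = y + d) ∨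
      ∃ p, m = p + 1 ∧ ∃ x ∈ F i, ∃ y ∈ F k, ∃ d ∈ setSums F t p, g = x + (y + d) := by
  rcases (mem_setSums_insert (by simp [hik, hi])).1 hg with h | ⟨x, hx, d, hd, rfl⟩
  · rcases (mem_setSums_insert hk).1 h with h | h
    · exact Or.inl h
    · exact Or.inr (Or.inr (Or.inl h))
  · rcases m with _ | p
    · rw [setSums_zero] at hd
      exact Or.inr (Or.inl ⟨x, hx, d, by rwa [setSums_zero], rfl⟩)
    · rcases (mem_setSums_insert hk).1 hd with h | ⟨y, hy, e, he, rfl⟩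
      · exact Or.inr (Or.inl ⟨x, hx, d, h, rfl⟩)
      · exact Or.inr (Or.inr (Or.inr ⟨p, rfl, x, hx, y, hy, e, he, rfl⟩))

theorem setSums_uncross_subset (hik : i ≠ k) (hi : i ∉ t) (hk : k ∉ t) (m : ℕ) :
    setSums (uncross F i k) (insert i (insert k t)) (m + 1) ⊆
      setSums F (insert i (insert k t)) (m + 1) := by
  have hcongr := setSums_congr (uncross_of_notMem F hi hk)
  intro g hg
  rcases mem_setSums_pair hik hi hk hg with h | ⟨x, hx, d, hd, rfl⟩ | ⟨y, hy, d, hd, rfl⟩ |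
    ⟨p, rfl, x, hx, y, hy, d, hd, rfl⟩
  · rw [hcongr] at h
    exact setSums_mono ((Finset.subset_insert k t).trans (Finset.subset_insert i _)) _ h
  · rw [hcongr] at hd
    rw [uncross_left F hik] at hx
    exact hx.elim (add_mem_setSums_pair_left hik hi · hd) (add_mem_setSums_pair_right hk · hd)
  · rw [hcongr] at hd
    rw [uncross_right] at hy
    exact add_mem_setSums_pair_right hk hy.2 hd
  · rw [hcongr] at hd
    rw [uncross_left F hik] at hx
    rw [uncross_right] at hy
    rcases hx with hx | hx
    · exact add_add_mem_setSums_pair hik hi hk hx hy.2 hd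
    · rw [add_left_comm]
      exact add_add_mem_setSums_pair hik hi hk hy.1 hx hd

open Classical in
theorem cosetHits_pair (hik : i ≠ k) (hi : i ∉ t) (hk : k ∉ t) (K : AddSubgroup G) (g : G) :
    cosetHits F (insert i (insert k t)) K g = cosetHits F t K g +
      (if g ∈ saturation K (F k) then 1 else 0) + if g ∈ saturation K (F i) then 1 else 0 := by
  rw [cosetHits_insert (by simp [hik, hi]), cosetHits_insert hk]

open Classical in
theorem cosetHits_uncross (hik : i ≠ k) (hi : i ∉ t) (hk : k ∉ t) (K : AddSubgroup G) (g : G) :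
    cosetHits (uncross F i k) (insert i (insert k t)) K g = cosetHits F t K g +
      (if g ∈ saturation K (F i ∩ F k) then 1 else 0) +
      if g ∈ saturation K (F i ∪ F k) then 1 else 0 := by
  rw [cosetHits_pair hik hi hk, cosetHits_congr (uncross_of_notMem F hi hk), uncross_left F hik,
    uncross_right]

variable [Fintype G]

theorem truncatedHits_uncross_le (hik : i ≠ k) (hi : i ∉ t) (hk : k ∉ t) (K : AddSubgroup G)
    (ℓ : ℕ) : truncatedHits (uncross F i k) (insert i (insert k t)) K ℓ ≤
      truncatedHits F (insert i (insert k t)) K ℓ := by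
  classical
  refine Finset.sum_le_sum fun g _ => min_le_min le_rfl ?_
  rw [cosetHits_uncross hik hi hk, cosetHits_pair hik hi hk, saturation_union]
  have h1 : g ∈ saturation K (F i ∩ F k) → g ∈ saturation K (F i) ∧ g ∈ saturation K (F k) :=
    fun h => ⟨saturation_mono le_rfl Set.inter_subset_left h,
      saturation_mono le_rfl Set.inter_subset_right h⟩
  by_cases ha : g ∈ saturation K (F i) <;> by_cases hb : g ∈ saturation K (F k) <;>
    by_cases hc : g ∈ saturation K (F i ∩ F k) <;> simp_all

theorem truncatedHits_le_uncross (hik : i ≠ k) (hi : i ∉ t) (hk : k ∉ t) {K : AddSubgroup G}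
    (hF : ∀ j, K ≤ period (F j)) (ℓ : ℕ) :
    truncatedHits F (insert i (insert k t)) K ℓ ≤
      truncatedHits (uncross F i k) (insert i (insert k t)) K ℓ := by
  classical
  refine Finset.sum_le_sum fun g _ => min_le_min le_rfl ?_
  rw [cosetHits_uncross hik hi hk, cosetHits_pair hik hi hk, saturation_union,
    saturation_eq_self (hF i), saturation_eq_self (hF k),
    saturation_eq_self (le_period_inter (hF i) (hF k))]
  by_cases ha : g ∈ F i <;> by_cases hb : g ∈ F k <;> simp_all

/-- Comparison of the truncated hits of the uncrossed family and of the family with both sets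
removed, for two nested subgroups. -/
theorem truncatedHits_uncross_add_le (hik : i ≠ k) (hi : i ∉ t) (hk : k ∉ t)
    {L H : AddSubgroup G} (hLH : L ≤ H) {a b : G} (ha : a ∈ F i) (hb : b ∈ F k) {J : Finset ι}
    (hJ : ∀ o ∈ t, o ∉ J → ∀ w ∈ F o, w - a ∉ H ∧ w - b ∉ H)
    (hV : ∀ v ∈ F i ∩ F k, v - a ∉ H ∧ v - b ∉ H) :
    truncatedHits (uncross F i k) (insert i (insert k t)) L (J.card + 1 + 1) +
        truncatedHits F t H J.card + {g : G | g - a ∈ H ∨ g - b ∈ H}.ncard ≤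
      truncatedHits (uncross F i k) (insert i (insert k t)) H (J.card + 1 + 1) +
        truncatedHits F t L J.card +
        (saturation L (F i ∪ F k) ∩ {g | g - a ∈ H ∨ g - b ∈ H}).ncard := by
  classical
  rw [← sum_ite_mem_eq_ncard, ← sum_ite_mem_eq_ncard]
  simp only [truncatedHits]
  rw [← Finset.sum_add_distrib, ← Finset.sum_add_distrib, ← Finset.sum_add_distrib,
    ← Finset.sum_add_distrib]
  refine Finset.sum_le_sum fun g _ => ?_
  rw [cosetHits_uncross hik hi hk, cosetHits_uncross hik hi hk]
  have hmono := cosetHits_mono F t hLH g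
  have hUmono : g ∈ saturation L (F i ∪ F k) → g ∈ saturation H (F i ∪ F k) :=
    fun h => saturation_mono hLH le_rfl h
  have hVmono : g ∈ saturation L (F i ∩ F k) → g ∈ saturation H (F i ∩ F k) :=
    fun h => saturation_mono hLH le_rfl h
  have hshift : ∀ w c : G, g - w ∈ H → g - c ∈ H → w - c ∈ H := fun w c h1 h2 => by
    simpa using H.sub_mem h2 h1
  by_cases hQ : g - a ∈ H ∨ g - b ∈ H
  · have hU : g ∈ saturation H (F i ∪ F k) :=
      hQ.elim (fun h => ⟨a, Or.inl ha, h⟩) fun h => ⟨b, Or.inr hb, h⟩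
    have hV' : g ∉ saturation H (F i ∩ F k) := by
      rintro ⟨v, hv, hgv⟩
      exact hQ.elim (fun h => (hV v hv).1 (hshift v a hgv h))
        fun h => (hV v hv).2 (hshift v b hgv h)
    have hV'' : g ∉ saturation L (F i ∩ F k) := fun h => hV' (hVmono h)
    have hN : cosetHits F t H g ≤ J.card := by
      refine cosetHits_le_card ?_
      rintro o ho hoJ ⟨w, hw, hgw⟩
      exact hQ.elim (fun h => (hJ o ho hoJ w hw).1 (hshift w a hgw h))
        fun h => (hJ o ho hoJ w hw).2 (hshift w b hgw h)
    by_cases hUL : g ∈ saturation L (F i ∪ F k) <;> simp [hU, hV', hV'', hUL, hQ] <;> omega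
  · have hQ' : g ∉ {g : G | g - a ∈ H ∨ g - b ∈ H} := hQ
    have hQU : g ∉ saturation L (F i ∪ F k) ∩ {g : G | g - a ∈ H ∨ g - b ∈ H} :=
      fun h => hQ' h.2
    rw [if_neg hQ', if_neg hQU]
    split_ifs with h1 h2 h3 h4 h5 h6 h7 <;> first | omega | (exfalso; tauto)

end Pairs

end AdditiveCombinatorics

section AdditiveCombinatorics

variable {G : Type*} [AddCommGroup G] {ι : Type*} [DecidableEq ι]

theorem exists_of_mem_crossSums {X Y : Set G} {K : AddSubgroup G} {a b w : G}
    (hw : w ∈ crossSums X Y K a b) : ∃ x ∈ X, ∃ y ∈ Y, w = x + y ∧ w - (a + b) ∈ K := by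
  rcases hw with ⟨x, hx, y, hy, rfl⟩ | ⟨x, hx, y, hy, rfl⟩
  · refine ⟨x, hx.1, y, hy.1, rfl, ?_⟩
    have h : x + y - (a + b) = x - a + (y - b) := by abel
    exact h ▸ K.add_mem hx.2 hy.2
  · refine ⟨x, hx.1, y, hy.1, rfl, ?_⟩
    have h : x + y - (a + b) = x - b + (y - a) := by abel
    exact h ▸ K.add_mem hx.2 hy.2

theorem le_period_crossSums {X Y : Set G} {L K : AddSubgroup G} (hX : L ≤ period X) (hLK : L ≤ K)
    (a b : G) : L ≤ period (crossSums X Y K a b) :=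
  le_period_union (le_period_add_left (le_period_cosetSlice hX hLK a) _)
    (le_period_add_left (le_period_cosetSlice hX hLK b) _)

/-- If a sum that escapes the uncrossed family is given, its two crossing summands can be chosen
such that the remaining sets avoid their cosets. -/
theorem exists_of_escapes_uncross {F : ι → Set G} {t : Finset ι} {i k : ι} (hik : i ≠ k)
    (hi : i ∉ t) (hk : k ∉ t) {m : ℕ} {H : AddSubgroup G} {c : G}
    (hc : c ∈ setSums F (insert i (insert k t)) (m + 1))
    (hesc : ∀ z ∈ setSums (uncross F i k) (insert i (insert k t)) (m + 1), z - c ∉ H) :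
    ∃ p, m = p + 1 ∧ ∃ a ∈ F i, ∃ b ∈ F k, ∃ d ∈ setSums F t p, c = a + (b + d) ∧
      (∃ J : Finset ι, J.card = p ∧
        ∀ o ∈ t, o ∉ J → ∀ w ∈ F o, w - a ∉ H ∧ w - b ∉ H) ∧
      ∀ v ∈ F i ∩ F k, v - a ∉ H ∧ v - b ∉ H := by
  have hcongr := setSums_congr (uncross_of_notMem F hi hk)
  have hU₁ : F i ⊆ uncross F i k i := by rw [uncross_left F hik]; exact Set.subset_union_left
  have hU₂ : F k ⊆ uncross F i k i := by rw [uncross_left F hik]; exact Set.subset_union_right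
  have hzero : c - c ∈ H := by simp
  rcases mem_setSums_pair hik hi hk hc with h | ⟨x, hx, d, hd, rfl⟩ | ⟨y, hy, d, hd, rfl⟩ |
    ⟨p, rfl, a, ha, b, hb, d, hd, rfl⟩
  · refine absurd hzero (hesc c ?_)
    rw [← hcongr] at h
    exact setSums_mono ((Finset.subset_insert k t).trans (Finset.subset_insert i _)) _ h
  · rw [← hcongr] at hd
    exact absurd hzero (hesc _ (add_mem_setSums_pair_left hik hi (hU₁ hx) hd))
  · rw [← hcongr] at hd
    exact absurd hzero (hesc _ (add_mem_setSums_pair_left hik hi (hU₂ hy) hd))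
  · have hshift₁ : ∀ w, b + (w + d) - (a + (b + d)) = w - a := fun w => by abel
    have hshift₂ : ∀ w, a + (w + d) - (a + (b + d)) = w - b := fun w => by abel
    refine ⟨p, rfl, a, ha, b, hb, d, hd, rfl, ?_, ?_⟩
    · obtain ⟨J, hJt, hJ, e, he, hed⟩ := hd
      refine ⟨J, hJ, fun o ho hoJ w hw => ?_⟩
      have hwd : w + d ∈ setSums (uncross F i k) t (p + 1) := by
        rw [hcongr]
        exact setSums_mono (Finset.insert_subset ho hJt) _
          (add_mem_setSums_insert hoJ hw ⟨J, subset_rfl, hJ, e, he, hed⟩)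
      rw [← hshift₁ w, ← hshift₂ w]
      exact ⟨hesc _ (add_mem_setSums_pair_left hik hi (hU₂ hb) hwd),
        hesc _ (add_mem_setSums_pair_left hik hi (hU₁ ha) hwd)⟩
    · intro v hv
      rw [← uncross_right] at hv
      rw [← hcongr] at hd
      rw [← hshift₁ v, ← hshift₂ v]
      exact ⟨hesc _ (add_add_mem_setSums_pair hik hi hk (hU₂ hb) hv hd),
        hesc _ (add_add_mem_setSums_pair hik hi hk (hU₁ ha) hv hd)⟩

variable [Fintype G]

/-- The case of the slice bound in which a used and an unused set are incomparable; the bound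
for the uncrossed family is transferred to the original one. -/
theorem sliceBound_of_uncross {F : ι → Set G} {t : Finset ι} {m : ℕ}
    {K : AddSubgroup G} {r c : G} {i k : ι}
    (ihℓ : ∀ p, p + 1 = m → ∀ (M K : AddSubgroup G) (r : G), SliceStatement F t p M K r)
    (hik : i ≠ k) (hi : i ∉ t) (hk : k ∉ t)
    (ihF : SliceStatement (uncross F i k) (insert i (insert k t)) (m + 1) ⊥ K r)
    (hper : ∀ j, period (cosetSlice (setSums F (insert i (insert k t)) (m + 1)) K r) ≤
      period (F j))
    (hcr : c - r ∈ K) {x d : G} (hx : x ∈ F i) (hd : d ∈ setSums F t m) (hc : c = x + d) :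
    SliceBound F (insert i (insert k t)) (m + 1) K
      (cosetSlice (setSums F (insert i (insert k t)) (m + 1)) K r)
      (period (cosetSlice (setSums F (insert i (insert k t)) (m + 1)) K r)) := by
  set s := insert i (insert k t) with hs
  set T := cosetSlice (setSums F s (m + 1)) K r with hT
  set E₀ := cosetSlice (setSums (uncross F i k) s (m + 1)) K r with hE₀
  have hE₀T : E₀ ⊆ T := fun z hz => ⟨setSums_uncross_subset hik hi hk m hz.1, hz.2⟩
  have hcE₀ : c ∈ E₀ := by
    refine ⟨?_, hcr⟩
    rw [hc, hs]
    refine add_mem_setSums_pair_left hik hi ?_ ?_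
    · rw [uncross_left F hik]; exact Or.inl hx
    · rwa [setSums_congr (uncross_of_notMem F hi hk)]
  have hTK : period T ≤ K := period_le_of_subset_coset ⟨c, hE₀T hcE₀⟩ fun y hy => hy.2
  let P : Set G → AddSubgroup G → Prop := fun E H =>
    E ⊆ T ∧ E₀ ⊆ E ∧ period T ≤ H ∧ H ≤ K ∧ H ≤ period E ∧
      SliceBound (uncross F i k) s (m + 1) K E H
  have hstart : P E₀ (period E₀) := by
    have hb := ihF bot_le ⟨c, hcE₀⟩
    rw [saturation_bot] at hb
    exact ⟨hE₀T, subset_rfl, le_period_cosetSlice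
      (le_period_setSums (le_period_uncross hper hik) s m) hTK r,
      period_le_of_subset_coset ⟨c, hcE₀⟩ fun y hy => hy.2, le_rfl, hb⟩
  have hstep : ∀ E H, P E H → ∀ c ∈ T, ∀ x ∉ T, x - c ∈ H → ∃ E' H', P E' H' ∧ H' < H := by
    rintro E H ⟨hET, hE₀E, hTH, hHK, hHE, hb⟩ c' hc' y hy hyc'
    have hdisj : ∀ z ∈ E, z - c' ∉ H := by
      intro z hz hzc
      refine hy (hET (mem_of_le_period hHE hz ?_))
      simpa using H.sub_mem hyc' hzc
    have hesc : ∀ z ∈ setSums (uncross F i k) s (m + 1), z - c' ∉ H := by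
      intro z hz hzc
      refine hdisj z (hE₀E ⟨hz, ?_⟩) hzc
      simpa using K.add_mem (hHK hzc) hc'.2
    obtain ⟨p, rfl, a, ha, b, hbk, d, hd, rfl, ⟨J, hJ, hJmiss⟩, hV⟩ :=
      exists_of_escapes_uncross hik hi hk hc'.1 hesc
    let W := crossSums (F i) (F k) H a b
    let Z := cosetSlice (setSums F t p) H d
    have hdZ : d ∈ Z := ⟨hd, by simp⟩
    have habW : a + b ∈ W := Or.inl ⟨a, ⟨ha, by simp⟩, b, ⟨hbk, by simp⟩, rfl⟩
    have hDC : ∀ z ∈ W + Z, z ∈ setSums F s (p + 1 + 1) ∧ z - (a + (b + d)) ∈ H := by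
      rintro _ ⟨w, hw, e, he, rfl⟩
      obtain ⟨x, hx, y, hy, rfl, hxy⟩ := exists_of_mem_crossSums hw
      refine ⟨?_, ?_⟩
      · dsimp only
        rw [add_assoc x y e]
        exact add_add_mem_setSums_pair hik hi hk hx hy he.1
      · have h : x + y + e - (a + (b + d)) = x + y - (a + b) + (e - d) := by abel
        exact h ▸ H.add_mem hxy he.2
    have hDT : W + Z ⊆ T := fun z hz =>
      ⟨(hDC z hz).1, by simpa using K.add_mem (hHK (hDC z hz).2) hc'.2⟩
    have hcD : a + (b + d) ∈ W + Z := ⟨a + b, habW, d, hdZ, by simp [add_assoc]⟩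
    have hLH : period (W + Z) ≤ H :=
      period_le_of_subset_coset ⟨_, hcD⟩ fun z hz => (hDC z hz).2
    have hyD : y ∉ W + Z := fun h => hy (hDT h)
    have hTL : period T ≤ period (W + Z) :=
      le_period_add_left (le_period_crossSums (hper i) hTH a b) Z
    refine ⟨E ∪ (W + Z), period (W + Z), ⟨Set.union_subset hET hDT,
      hE₀E.trans Set.subset_union_left, hTL, hLH.trans hHK,
      le_period_union (hLH.trans hHE) le_rfl, ?_⟩, lt_of_le_of_ne hLH ?_⟩
    · have hkn := kneser_addition ⟨_, habW⟩ ⟨_, hdZ⟩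
      have hind := ihℓ p rfl (period (W + Z)) H d hLH ⟨d, hdZ⟩
      change SliceBound F t p H (saturation (period (W + Z)) Z)
        (period (saturation (period (W + Z)) Z)) at hind
      rw [period_saturation_right] at hind
      have hpair := ncard_saturation_union_add_card_le hLH ha hbk period_saturation_left
        ⟨y - d, by
          have h : y - d - (a + b) = y - (a + (b + d)) := by abel
          rwa [h], fun hmem => hyD (by
          rw [← saturation_eq_self (le_refl (period (W + Z))), ← saturation_add_saturation]
          exact ⟨y - d, hmem, d, subset_saturation _ _ hdZ, by simp⟩)⟩
      have hhits := truncatedHits_uncross_add_le hik hi hk hLH ha hbk hJmiss hV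
      rw [hJ] at hhits
      unfold SliceBound at hb hind ⊢
      rw [Set.ncard_union_eq (Set.disjoint_left.2 fun z hz hzD => hdisj z hz (hDC z hzD).2)]
      simp only [add_mul, one_mul] at hb ⊢
      change _ ≤ (saturation (period (W + Z)) W).ncard + _ + _ at hpair
      rw [← hs] at hhits
      omega
    · intro heq
      exact hyD (mem_of_le_period heq.ge hcD hyc')
  obtain ⟨E', hE', -, -, -, -, hb⟩ :=
    exists_of_period_descent (fun E H h => h.2.2.1) hstep hstart
  have h1 := Set.ncard_le_ncard hE' (Set.toFinite _)
  have h2 := truncatedHits_uncross_le (F := F) hik hi hk K (m + 1)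
  have h3 := truncatedHits_le_uncross hik hi hk hper (m + 1)
  rw [← hs] at h2 h3
  unfold SliceBound at hb ⊢
  omega

end AdditiveCombinatorics

section AdditiveCombinatorics

variable {G : Type*} [AddCommGroup G] [Fintype G] {ι : Type*}

/-- The potential driving the uncrossing argument. -/
noncomputable def sumSqNcard {α : Type*} (F : ι → Set α) (s : Finset ι) : ℕ :=
  ∑ i ∈ s, (F i).ncard ^ 2

theorem sumSqNcard_le {α : Type*} [Finite α] (F : ι → Set α) (s : Finset ι) :
    sumSqNcard F s ≤ s.card * Nat.card α ^ 2 := by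
  refine Finset.sum_le_card_nsmul _ _ _ fun i _ => Nat.pow_le_pow_left ?_ 2
  rw [← Set.ncard_univ]
  exact Set.ncard_le_ncard (Set.subset_univ _) (Set.toFinite _)

theorem sumSqNcard_le_saturation (K : AddSubgroup G) (F : ι → Set G) (s : Finset ι) :
    sumSqNcard F s ≤ sumSqNcard (fun i => saturation K (F i)) s :=
  Finset.sum_le_sum fun _ _ => Nat.pow_le_pow_left
    (Set.ncard_le_ncard (subset_saturation _ _) (Set.toFinite _)) 2

theorem sumSqNcard_lt_uncross {α : Type*} [Finite α] [DecidableEq ι] {F : ι → Set α}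
    {t : Finset ι} {i k : ι} (hik : i ≠ k) (hi : i ∉ t) (hk : k ∉ t) (h₁ : ¬ F i ⊆ F k)
    (h₂ : ¬ F k ⊆ F i) :
    sumSqNcard F (insert i (insert k t)) <
      sumSqNcard (uncross F i k) (insert i (insert k t)) := by
  have hi' : i ∉ insert k t := by simp [hik, hi]
  have hrest : ∑ j ∈ t, (uncross F i k j).ncard ^ 2 = ∑ j ∈ t, (F j).ncard ^ 2 :=
    Finset.sum_congr rfl fun j hj => by rw [uncross_of_notMem F hi hk j hj]
  unfold sumSqNcard
  rw [Finset.sum_insert hi', Finset.sum_insert hk, Finset.sum_insert hi', Finset.sum_insert hk,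
    hrest, uncross_left F hik, uncross_right]
  have e1 := Set.ncard_union_add_ncard_inter (F i) (F k)
  have e2 : (F i ∩ F k).ncard < (F i).ncard := Set.ncard_lt_ncard
    ⟨Set.inter_subset_left, fun h => h₁ fun x hx => (h hx).2⟩ (Set.toFinite _)
  have e3 : (F i ∩ F k).ncard < (F k).ncard := Set.ncard_lt_ncard
    ⟨Set.inter_subset_right, fun h => h₂ fun x hx => (h hx).1⟩ (Set.toFinite _)
  zify at *
  nlinarith [mul_pos (sub_pos.2 e2) (sub_pos.2 e3)]

/-- Passing to the periodic hull of the family reduces the slice statement to the case of a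
family whose members are periodic. -/
theorem sliceStatement_of_saturation {F : ι → Set G} {s : Finset ι} {ℓ : ℕ} {M K : AddSubgroup G}
    {r : G}
    (h : ∀ L, L = period (saturation M (cosetSlice (setSums F s ℓ) K r)) →
      L ≤ K → (cosetSlice (setSums (fun i => saturation L (F i)) s ℓ) K r).Nonempty →
      period (cosetSlice (setSums (fun i => saturation L (F i)) s ℓ) K r) = L →
      SliceBound (fun i => saturation L (F i)) s ℓ K
        (cosetSlice (setSums (fun i => saturation L (F i)) s ℓ) K r)
        (period (cosetSlice (setSums (fun i => saturation L (F i)) s ℓ) K r)))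
    (hper : ∀ L, L ≤ period (setSums (fun i => saturation L (F i)) s ℓ)) :
    SliceStatement F s ℓ M K r := by
  intro hMK hne
  set X := saturation M (cosetSlice (setSums F s ℓ) K r) with hX
  have hXne : X.Nonempty := saturation_nonempty.2 hne
  have hLK : period X ≤ K :=
    period_le_of_subset_coset hXne fun x hx => saturation_cosetSlice_subset hMK hx
  have hML : M ≤ period X := le_period_saturation _ _
  have hC : setSums (fun i => saturation (period X) (F i)) s ℓ =
      saturation (period X) (setSums F s ℓ) := by
    rw [← setSums_saturation, saturation_eq_self (hper _)]
  have hslice : cosetSlice (setSums (fun i => saturation (period X) (F i)) s ℓ) K r = X := by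
    rw [hC]
    refine Set.Subset.antisymm ?_ ?_
    · rintro z ⟨hz, hzr⟩
      have h1 := mem_saturation_cosetSlice hLK hz hzr
      have h2 := saturation_mono le_rfl (subset_saturation M _) h1
      rwa [← hX, saturation_eq_self le_rfl] at h2
    · intro z hz
      exact ⟨saturation_mono hML (fun _ h => h.1) hz, saturation_cosetSlice_subset hMK hz⟩
  have hmain := h (period X) rfl hLK (by rw [hslice]; exact hXne) (by rw [hslice])
  rw [hslice] at hmain
  unfold SliceBound truncatedHits at hmain ⊢
  simp only [cosetHits_saturation F s hLK, cosetHits_saturation F s (le_refl (period X))] at hmain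
  exact hmain

/-- The slice bound holds for all families, all subgroups and all cosets. -/
theorem sliceStatement_holds (ℓ : ℕ) : ∀ (F : ι → Set G) (s : Finset ι) (M K : AddSubgroup G)
    (r : G), SliceStatement F s ℓ M K r := by
  classical
  induction ℓ using Nat.strong_induction_on with
  | _ ℓ ihℓ =>
  rcases ℓ with _ | m
  · exact sliceStatement_zero
  suffices h : ∀ (s : Finset ι) (K : AddSubgroup G) (N : ℕ) (F : ι → Set G),
      s.card * Nat.card G ^ 2 - sumSqNcard F s ≤ N → ∀ (M : AddSubgroup G) (r : G),
        SliceStatement F s (m + 1) M K r from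
    fun F s M K r => h s K _ F le_rfl M r
  intro s K
  induction K using WellFoundedLT.induction with
  | ind K ihK =>
  intro N
  induction N using Nat.strong_induction_on with
  | _ N ihN =>
  intro F hN M r
  refine sliceStatement_of_saturation ?_ fun L =>
    le_period_setSums (fun i => le_period_saturation _ _) s m
  intro L _ hLK hne hL
  have hmono := sumSqNcard_le_saturation L F s
  set F₁ : ι → Set G := fun i => saturation L (F i)
  have hper : ∀ i, period (cosetSlice (setSums F₁ s (m + 1)) K r) ≤ period (F₁ i) := by
    intro i
    rw [hL]
    exact le_period_saturation _ _
  obtain ⟨c, hc, hcr⟩ := hne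
  rcases setSums_incomparable_or_dominating hc with
    ⟨i, k, t, hik, hi, hk, rfl, h₁, h₂, x, hx, d, hd, hcx⟩ |
    ⟨i, t, J, hi, hs, hJ, hdom, x, hx, d, hd, hcx⟩
  · refine sliceBound_of_uncross (fun p hp M K r => ihℓ p (by omega) F₁ t M K r) hik hi hk ?_ hper
      hcr hx hd hcx
    have hlt := sumSqNcard_lt_uncross hik hi hk h₁ h₂
    have hle := sumSqNcard_le (uncross F₁ i k) (insert i (insert k t))
    exact ihN _ (by omega) _ le_rfl ⊥ r
  · exact sliceBound_of_dominating (fun s M K r => ihℓ m (by omega) F₁ s M K r)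
      (fun K' hK' M r => ihK K' hK' _ F₁ le_rfl M r) hper hcr hi hs hJ hdom hx hd hcx

/-- A local form of the theorem of DeVos, Goddyn and Mohar on sums of `ℓ` sets chosen from a
family: a lower bound for the number of cosets of `M` containing such a sum. -/
theorem truncatedHits_add_card_le {F : ι → Set G} {s : Finset ι} {ℓ : ℕ}
    (hF : ∀ i ∈ s, (F i).Nonempty) (hℓ : ℓ ≤ s.card) {M L : AddSubgroup G}
    (hL : L = period (saturation M (setSums F s ℓ))) :
    Nat.card L + truncatedHits F s L ℓ ≤
      (saturation M (setSums F s ℓ)).ncard + ℓ * Nat.card L := by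
  classical
  have htop : cosetSlice (setSums F s ℓ) ⊤ 0 = setSums F s ℓ := by
    ext g
    simp [mem_cosetSlice]
  have hne : (setSums F s ℓ).Nonempty := by
    obtain ⟨I, hI, hcard⟩ := Finset.exists_subset_card_eq hℓ
    choose! a ha using hF
    exact ⟨_, I, hI, hcard, a, fun i hi => ha i (hI hi), rfl⟩
  have h := sliceStatement_holds ℓ F s M ⊤ 0 le_top (by rwa [htop])
  rw [htop, ← hL] at h
  have hupper : truncatedHits F s ⊤ ℓ ≤ ℓ * Nat.card (⊤ : AddSubgroup G) := by
    rw [truncatedHits, AddSubgroup.card_top, Nat.card_eq_fintype_card, mul_comm]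
    exact Finset.sum_le_card_nsmul _ _ _ fun g _ => min_le_left _ _
  unfold SliceBound at h
  omega

end AdditiveCombinatorics

section AdditiveCombinatorics

variable {G : Type*} [AddCommGroup G] [Finite G]

/-- **Scherk's theorem**: if `0` is uniquely a sum of an element of `A` and one of `B`, then
`|A| + |B| ≤ |A + B| + 1`. -/
theorem scherk_addition {A B : Set G} (hA : (0 : G) ∈ A) (hB : (0 : G) ∈ B)
    (h : ∀ a ∈ A, ∀ b ∈ B, a + b = 0 → a = 0) : A.ncard + B.ncard ≤ (A + B).ncard + 1 := by
  have hkn := kneser_addition ⟨0, hA⟩ ⟨0, hB⟩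
  set H := period (A + B)
  have hH : Nat.card H = (H : Set G).ncard := Nat.card_coe_set_eq _
  have hsat : ∀ X : Set G, (0 : G) ∈ X →
      X.ncard + Nat.card H ≤ (saturation H X).ncard + (X ∩ H).ncard := by
    intro X hX
    rw [hH, ← Set.ncard_union_add_ncard_inter]
    refine Nat.add_le_add_right (Set.ncard_le_ncard ?_ (Set.toFinite _)) _
    exact Set.union_subset (subset_saturation H X) fun g hg => ⟨0, hX, by simpa using hg⟩
  have h1 := hsat A hA
  have h2 := hsat B hB
  have h3 : (A ∩ H).ncard + (B ∩ H).ncard ≤ Nat.card H + 1 := by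
    rw [← Set.ncard_image_of_injective (B ∩ H) neg_injective, ← Set.ncard_union_add_ncard_inter,
      hH]
    refine add_le_add (Set.ncard_le_ncard ?_ (Set.toFinite _)) ?_
    · rintro g (hg | ⟨b, hb, rfl⟩)
      · exact hg.2
      · exact H.neg_mem hb.2
    · rw [← Set.ncard_singleton (0 : G)]
      refine Set.ncard_le_ncard ?_ (Set.toFinite _)
      rintro g ⟨hg, b, hb, rfl⟩
      exact h _ hg.1 b hb.1 (by simp)
  omega

theorem exists_coloring {ι β : Type*} (s : Finset ι) (f : ι → β) {h : ℕ}
    (hf : ∀ v, ∀ I ⊆ s, (∀ i ∈ I, f i = v) → I.card ≤ h) :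
    ∃ κ : ι → ℕ, (∀ i ∈ s, κ i < h) ∧ ∀ i ∈ s, ∀ j ∈ s, κ i = κ j → f i = f j → i = j := by
  classical
  let fib : β → Finset ι := fun v => s.filter fun i => f i = v
  have hmem : ∀ {i}, i ∈ s → i ∈ fib (f i) := fun hi => Finset.mem_filter.2 ⟨hi, rfl⟩
  let κ' : β → ι → ℕ := fun v i => if hi : i ∈ fib v then ((fib v).equivFin ⟨i, hi⟩).val else 0
  refine ⟨fun i => κ' (f i) i, fun i hi => ?_, fun i hi j hj hκ hij => ?_⟩
  · simp only [κ', dif_pos (hmem hi)]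
    refine lt_of_lt_of_le (Fin.is_lt _) (hf (f i) _ (Finset.filter_subset _ _) fun j hj => ?_)
    exact (Finset.mem_filter.1 hj).2
  · have hj' : j ∈ fib (f i) := hij ▸ hmem hj
    dsimp only at hκ
    rw [← hij] at hκ
    simp only [κ', dif_pos (hmem hi), dif_pos hj'] at hκ
    have := (fib (f i)).equivFin.injective (Fin.ext hκ)
    simpa using this

/-- A family of at least `|G|` nonzero elements, each value being taken at most `h` times, has a
nonempty subfamily of at most `h` members with sum zero. -/
theorem exists_short_zero_sum {ι : Type*} (s : Finset ι) (f : ι → G) {h : ℕ}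
    (hs : Nat.card G ≤ s.card) (h0 : ∀ i ∈ s, f i ≠ 0)
    (hf : ∀ v, ∀ I ⊆ s, (∀ i ∈ I, f i = v) → I.card ≤ h) :
    ∃ I ⊆ s, I.Nonempty ∧ I.card ≤ h ∧ ∑ i ∈ I, f i = 0 := by
  classical
  by_contra hcon
  push Not at hcon
  obtain ⟨κ, hκ, hinj⟩ := exists_coloring s f hf
  let P : ℕ → Set G := fun m =>
    {g | ∃ I ⊆ s, I.card ≤ m ∧ (∀ i ∈ I, κ i < m) ∧ ∑ i ∈ I, f i = g}
  have hP0 : ∀ m, (0 : G) ∈ P m := fun m => ⟨∅, by simp⟩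
  have key : ∀ m ≤ h, (s.filter fun i => κ i < m).card + 1 ≤ (P m).ncard := by
    intro m
    induction m with
    | zero =>
      intro _
      have : 1 ≤ (P 0).ncard := (Set.ncard_pos (Set.toFinite _)).2 ⟨0, hP0 0⟩
      simpa using this
    | succ m ih =>
      intro hm
      let C := s.filter fun i => κ i = m
      have hC : ∀ i ∈ C, i ∈ s ∧ κ i = m := fun i hi => Finset.mem_filter.1 hi
      let B : Set G := insert 0 (f '' C)
      have hB : B.ncard = C.card + 1 := by
        rw [Set.ncard_insert_of_notMem _ (Set.toFinite _), Set.InjOn.ncard_image,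
          Set.ncard_coe_finset]
        · intro i hi j hj hij
          exact hinj i (hC i hi).1 j (hC j hj).1 ((hC i hi).2.trans (hC j hj).2.symm) hij
        · rintro ⟨i, hi, hi0⟩
          exact h0 i (hC i hi).1 hi0
      have hsum : ∀ I ⊆ s, I.card ≤ m → (∀ i ∈ I, κ i < m) → ∀ j ∈ C,
          insert j I ⊆ s ∧ (insert j I).card ≤ m + 1 ∧ (∀ i ∈ insert j I, κ i < m + 1) ∧
            ∑ i ∈ insert j I, f i = ∑ i ∈ I, f i + f j := by
        intro I hI hIc hIκ j hj
        have hjI : j ∉ I := fun hmem => (hIκ j hmem).ne (hC j hj).2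
        refine ⟨Finset.insert_subset (hC j hj).1 hI, ?_, ?_, ?_⟩
        · rw [Finset.card_insert_of_notMem hjI]; omega
        · intro i hi
          rcases Finset.mem_insert.1 hi with rfl | hi'
          · rw [(hC i hj).2]; omega
          · exact (hIκ i hi').trans (Nat.lt_succ_self m)
        · rw [Finset.sum_insert hjI, add_comm]
      have hsch : (P m).ncard + B.ncard ≤ (P m + B).ncard + 1 := by
        refine scherk_addition (hP0 m) (Set.mem_insert _ _) ?_
        rintro _ ⟨I, hI, hIc, hIκ, rfl⟩ b (rfl | ⟨j, hj, rfl⟩) hab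
        · simpa using hab
        · obtain ⟨h1, h2, -, h4⟩ := hsum I hI hIc hIκ j hj
          exact absurd (h4.trans hab) (hcon _ h1 (Finset.insert_nonempty _ _) (h2.trans hm))
      have hsub : P m + B ⊆ P (m + 1) := by
        rintro _ ⟨_, ⟨I, hI, hIc, hIκ, rfl⟩, b, rfl | ⟨j, hj, rfl⟩, rfl⟩
        · exact ⟨I, hI, hIc.trans (Nat.le_succ m),
            fun i hi => (hIκ i hi).trans (Nat.lt_succ_self m),
            by simp⟩
        · exact ⟨insert j I, hsum I hI hIc hIκ j hj⟩
      have hle := Set.ncard_le_ncard hsub (Set.toFinite _)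
      have hsplit : (s.filter fun i => κ i < m + 1).card =
          (s.filter fun i => κ i < m).card + C.card := by
        rw [← Finset.card_union_of_disjoint]
        · congr 1
          ext i
          simp only [C, Finset.mem_filter, Finset.mem_union, Nat.lt_succ_iff_lt_or_eq]
          tauto
        · rw [Finset.disjoint_left]
          intro i hi hi'
          exact (Finset.mem_filter.1 hi).2.ne (hC i hi').2
      have := ih (by omega)
      omega
  have hall := key h le_rfl
  rw [Finset.filter_true_of_mem hκ] at hall
  have hle : (P h).ncard ≤ Nat.card G := by
    rw [← Set.ncard_univ]
    exact Set.ncard_le_ncard (Set.subset_univ _) (Set.toFinite _)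
  omega

/-- Greedy extraction of disjoint blocks of size at most `h`: their union misses fewer than `e`
elements, and unions of some of the blocks approximate every admissible size up to `h`. -/
theorem exists_union_of_blocks {ι : Type*} {Z : Finset ι → Prop} (hZ : Z ∅)
    [DecidableEq ι] (hunion : ∀ I J, Disjoint I J → Z I → Z J → Z (I ∪ J)) {S : Finset ι} {e h : ℕ}
    (hblock : ∀ T ⊆ S, e ≤ T.card → ∃ B ⊆ T, B.Nonempty ∧ B.card ≤ h ∧ Z B) :
    ∃ V ⊆ S, (S \ V).card < e ∧ Z V ∧
      ∀ r ≤ V.card + h, ∃ V' ⊆ V, Z V' ∧ V'.card ≤ r ∧ r ≤ V'.card + h := by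
  classical
  let Q : Finset ι → Prop := fun V => Z V ∧
    ∀ r ≤ V.card + h, ∃ V' ⊆ V, Z V' ∧ V'.card ≤ r ∧ r ≤ V'.card + h
  have hQ0 : Q ∅ := ⟨hZ, fun r hr => ⟨∅, subset_rfl, hZ, by simp, hr⟩⟩
  obtain ⟨V, hV, hmax⟩ := Finset.exists_max_image (S.powerset.filter Q) Finset.card
    ⟨∅, by simp [hQ0]⟩
  obtain ⟨hVS, hZV, hr⟩ : V ⊆ S ∧ Q V := by simpa using hV
  refine ⟨V, hVS, ?_, hZV, hr⟩
  by_contra hge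
  obtain ⟨B, hB, hBne, hBh, hZB⟩ := hblock (S \ V) Finset.sdiff_subset (not_lt.1 hge)
  have hdisj : Disjoint V B := Finset.disjoint_of_subset_right hB Finset.disjoint_sdiff
  have hcard := Finset.card_union_of_disjoint hdisj
  have hpos := hBne.card_pos
  have hQ : Q (V ∪ B) := by
    refine ⟨hunion V B hdisj hZV hZB, fun r hrle => ?_⟩
    by_cases hrV : r ≤ V.card + h
    · obtain ⟨V', hV', h'⟩ := hr r hrV
      exact ⟨V', hV'.trans Finset.subset_union_left, h'⟩
    · exact ⟨V ∪ B, subset_rfl, hunion V B hdisj hZV hZB, by omega, hrle⟩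
  have := hmax (V ∪ B) (Finset.mem_filter.2 ⟨Finset.mem_powerset.2
    (Finset.union_subset hVS (hB.trans Finset.sdiff_subset)), hQ⟩)
  omega

end AdditiveCombinatorics

section WeightedZeroSums

/-- The terms `x i`, `i ∈ I`, admit weights in `A` for which the weighted sum lies in `K`. -/
def IsWeightedSumIn {R ι : Type*} [CommRing R] (A : Set R) (K : AddSubgroup R) (x : ι → R)
    (I : Finset ι) : Prop :=
  ∃ w : ι → R, (∀ i ∈ I, w i ∈ A) ∧ ∑ i ∈ I, w i * x i ∈ K

theorem isWeightedSumIn_empty {R ι : Type*} [CommRing R] (A : Set R) (K : AddSubgroup R)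
    (x : ι → R) : IsWeightedSumIn A K x ∅ := ⟨0, by simp, by simp⟩

theorem IsWeightedSumIn.union {R ι : Type*} [CommRing R] [DecidableEq ι] {A : Set R}
    {K : AddSubgroup R} {x : ι → R} {I J : Finset ι} (hIJ : Disjoint I J)
    (hI : IsWeightedSumIn A K x I) (hJ : IsWeightedSumIn A K x J) :
    IsWeightedSumIn A K x (I ∪ J) := by
  obtain ⟨w, hw, hwK⟩ := hI
  obtain ⟨u, hu, huK⟩ := hJ
  have hJI : ∀ i ∈ J, i ∉ I := fun i hi hi' => Finset.disjoint_left.1 hIJ hi' hi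
  refine ⟨fun i => if i ∈ I then w i else u i, fun i hi => ?_, ?_⟩
  · by_cases h : i ∈ I
    · simpa [h] using hw i h
    · simpa [h] using hu i ((Finset.mem_union.1 hi).resolve_left h)
  · rw [Finset.sum_union hIJ]
    refine K.add_mem ?_ ?_
    · rwa [Finset.sum_congr rfl fun i hi => congrArg (· * x i) (if_pos hi)]
    · rwa [Finset.sum_congr rfl fun i hi => congrArg (· * x i) (if_neg (hJI i hi))]

/-- The elements all of whose `A`-multiples agree modulo `K`. -/
def singleMultiples {R : Type*} [CommRing R] (A : Set R) (K : AddSubgroup R) : AddSubgroup R where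
  carrier := {y | ∀ a ∈ A, ∀ b ∈ A, a * y - b * y ∈ K}
  zero_mem' := by simp
  add_mem' := by
    intro y z hy hz a ha b hb
    have := K.add_mem (hy a ha b hb) (hz a ha b hb)
    convert this using 1
    ring
  neg_mem' := by
    intro y hy a ha b hb
    have := K.neg_mem (hy a ha b hb)
    convert this using 1
    ring

/-- Every family of `D` elements of `R` indexed by `ι` has a nonempty `A`-weighted
zero-sum subfamily. -/
def HasDavenportBound (ι : Type*) {R : Type*} [CommRing R] (A : Set R) (D : ℕ) : Prop :=
  ∀ (S : Finset ι) (x : ι → R), D ≤ S.card → ∃ I ⊆ S, I.Nonempty ∧ IsWeightedSumIn A ⊥ x I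

theorem IsWeightedSumIn.mono {R ι : Type*} [CommRing R] {A : Set R} {K L : AddSubgroup R}
    {x : ι → R} {I : Finset ι} (hKL : K ≤ L) (h : IsWeightedSumIn A K x I) :
    IsWeightedSumIn A L x I :=
  let ⟨w, hw, hwK⟩ := h
  ⟨w, hw, hKL hwK⟩

variable {n : ℕ} {ι : Type*} {A : Set (ZMod n)} {D : ℕ}

theorem HasDavenportBound.pos {R : Type*} [CommRing R] {A : Set R}
    (hD : HasDavenportBound ι A D) : 0 < D := by
  by_contra h
  obtain ⟨I, hI, hIne, -⟩ := hD ∅ 0 (by omega)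
  exact hIne.ne_empty (Finset.subset_empty.1 hI)

theorem card_map_singleMultiples_le (hD : HasDavenportBound ι A D) (K : AddSubgroup (ZMod n))
    {a₀ : ZMod n} (ha₀ : a₀ ∈ A) {s : Finset ι} (hs : D ≤ s.card) :
    Nat.card ((singleMultiples A K).map
      ((QuotientAddGroup.mk' K).comp (AddMonoidHom.mulLeft a₀))) ≤ D := by
  by_contra hlt
  set ψ := (QuotientAddGroup.mk' K).comp (AddMonoidHom.mulLeft a₀)
  have hcyc : IsAddCyclic (ZMod n ⧸ K) :=
    isAddCyclic_of_surjective (QuotientAddGroup.mk' K) (QuotientAddGroup.mk'_surjective K)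
  obtain ⟨⟨_, y, hy, rfl⟩, hγ⟩ := IsAddCyclic.exists_ofOrder_eq_natCard
    (α := (singleMultiples A K).map ψ)
  rw [← AddSubgroup.addOrderOf_coe] at hγ
  obtain ⟨S, hS, hSc⟩ := Finset.exists_subset_card_eq hs
  obtain ⟨I, hI, hIne, w, hw, hw0⟩ := hD S (fun _ => y) hSc.ge
  have hmem : I.card • (a₀ * y) ∈ K := by
    have h1 : ∑ i ∈ I, (w i * y - a₀ * y) ∈ K :=
      K.sum_mem fun i hi => hy _ (hw i hi) _ ha₀
    rw [Finset.sum_sub_distrib, Finset.sum_const, (AddSubgroup.mem_bot).1 hw0, zero_sub] at h1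
    simpa using h1
  have hzero : I.card • ψ y = 0 := by
    rw [← map_nsmul]
    simpa [ψ, mul_left_comm] using hmem
  have hdvd := Nat.le_of_dvd hIne.card_pos (addOrderOf_dvd_of_nsmul_eq_zero hzero)
  have := Finset.card_le_card hI
  simp only at hγ
  omega

variable [NeZero n]

open Classical in
theorem exists_isWeightedSumIn_of_few_multiples (hD : HasDavenportBound ι A D)
    (hA : A.Nonempty) (x : ι → ZMod n) (K : AddSubgroup (ZMod n)) {s : Finset ι}
    (hs : s.card + 1 = n + D)
    (ht : (s.filter fun i => x i ∉ singleMultiples A K).card + D + 1 ≤ n) :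
    ∃ I ⊆ s, I.card = n ∧ IsWeightedSumIn A K x I := by
  obtain ⟨a₀, ha₀⟩ := hA
  set ψ := (QuotientAddGroup.mk' K).comp (AddMonoidHom.mulLeft a₀) with hψ
  have hψ0 : ∀ y, ψ y = 0 ↔ a₀ * y ∈ K := fun y => by simp [hψ]
  set T₀ := s.filter fun i => x i ∉ singleMultiples A K with hT₀
  set S₁ := s.filter fun i => x i ∈ singleMultiples A K with hS₁
  have hsplit : S₁.card + T₀.card = s.card := Finset.card_filter_add_card_filter_not _
  have hS₁x : ∀ i ∈ S₁, x i ∈ singleMultiples A K := fun i hi => (Finset.mem_filter.1 hi).2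
  have hDpos := hD.pos
  obtain ⟨i₀, hi₀, hmax⟩ := Finset.exists_max_image S₁
    (fun j => (S₁.filter fun i => ψ (x i) = ψ (x j)).card) (Finset.card_pos.1 (by omega))
  set Z := S₁.filter fun i => ψ (x i) = ψ (x i₀) with hZ
  set y : ι → ZMod n := fun i => x i - x i₀ with hy
  have hyS : ∀ i ∈ S₁, y i ∈ singleMultiples A K := fun i hi =>
    AddSubgroup.sub_mem _ (hS₁x i hi) (hS₁x i₀ hi₀)
  suffices h : ∃ I ⊆ s, I.card = n ∧ IsWeightedSumIn A K y I by
    obtain ⟨I, hI, hIn, w, hw, hwK⟩ := h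
    refine ⟨I, hI, hIn, w, hw, ?_⟩
    have h1 : ∑ i ∈ I, (w i * x i₀ - a₀ * x i₀) ∈ K :=
      K.sum_mem fun i hi => hS₁x i₀ hi₀ _ (hw i hi) _ ha₀
    have h2 : ∑ i ∈ I, a₀ * x i₀ = 0 := by simp [hIn]
    rw [Finset.sum_sub_distrib, h2, sub_zero] at h1
    have h3 := K.add_mem hwK h1
    rw [← Finset.sum_add_distrib] at h3
    simpa [hy, mul_sub] using h3
  have hZS : Z ⊆ S₁ := Finset.filter_subset _ _
  have hZy : ∀ I ⊆ Z, IsWeightedSumIn A K y I := by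
    refine fun I hI => ⟨fun _ => a₀, fun _ _ => ha₀, K.sum_mem fun i hi => ?_⟩
    rw [← hψ0, hy, map_sub, (Finset.mem_filter.1 (hI hi)).2, sub_self]
  set Γ := (singleMultiples A K).map ψ with hΓ
  have hΓD : Nat.card Γ ≤ D :=
    card_map_singleMultiples_le hD K ha₀ (s := s) (by have := NeZero.pos n; omega)
  have hblock : ∀ T ⊆ S₁ \ Z, Nat.card Γ ≤ T.card →
      ∃ B ⊆ T, B.Nonempty ∧ B.card ≤ Z.card ∧ IsWeightedSumIn A K y B := by
    intro T hT hTc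
    have hT₁ : ∀ i ∈ T, i ∈ S₁ := fun i hi => (Finset.mem_sdiff.1 (hT hi)).1
    let f : ι → Γ := fun i =>
      if hi : i ∈ S₁ then ⟨ψ (y i), AddSubgroup.mem_map_of_mem ψ (hyS i hi)⟩ else 0
    have hf : ∀ i ∈ T, (f i : ZMod n ⧸ K) = ψ (y i) := fun i hi => by
      simp only [f, dif_pos (hT₁ i hi)]
    have hne : ∀ i ∈ T, f i ≠ 0 := by
      intro i hi h0
      have h1 : ψ (y i) = 0 := by rw [← hf i hi, h0]; rfl
      rw [hy, map_sub, sub_eq_zero] at h1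
      exact (Finset.mem_sdiff.1 (hT hi)).2 (Finset.mem_filter.2 ⟨hT₁ i hi, h1⟩)
    have hfib : ∀ v, ∀ I ⊆ T, (∀ i ∈ I, f i = v) → I.card ≤ Z.card := by
      intro v I hI hIv
      obtain rfl | ⟨j, hj⟩ := I.eq_empty_or_nonempty
      · simp
      refine (Finset.card_le_card fun i hi => ?_).trans (hmax j (hT₁ j (hI hj)))
      refine Finset.mem_filter.2 ⟨hT₁ i (hI hi), ?_⟩
      have h1 : ψ (y i) = ψ (y j) := by rw [← hf i (hI hi), ← hf j (hI hj), hIv i hi, hIv j hj]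
      simpa [hy] using h1
    obtain ⟨B, hB, hBne, hBc, hB0⟩ := exists_short_zero_sum T f hTc hne hfib
    refine ⟨B, hB, hBne, hBc, fun _ => a₀, fun _ _ => ha₀, ?_⟩
    rw [← Finset.mul_sum, ← hψ0, map_sum, ← Finset.sum_congr rfl fun i hi => hf i (hB hi)]
    simpa using congrArg (Subtype.val) hB0
  obtain ⟨V, hV, hVc, -, hVr⟩ := exists_union_of_blocks (isWeightedSumIn_empty A K y)
    (fun _ _ => IsWeightedSumIn.union) hblock
  set R₀ := T₀ ∪ ((S₁ \ Z) \ V) with hR₀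
  obtain ⟨W₀, hW₀, hW₀c, hW₀Z, -⟩ := exists_union_of_blocks (S := R₀) (e := D) (h := R₀.card)
    (isWeightedSumIn_empty A K y) (fun _ _ => IsWeightedSumIn.union) (fun T hT hTc => by
      obtain ⟨I, hI, hIne, hI0⟩ := hD T y hTc
      exact ⟨I, hI, hIne, Finset.card_le_card (hI.trans hT), hI0.mono bot_le⟩)
  have hTS : Disjoint T₀ S₁ := (Finset.disjoint_filter_filter_not _ _ _).symm
  have hR₀c : R₀.card = T₀.card + ((S₁ \ Z) \ V).card := Finset.card_union_of_disjoint
    (hTS.mono_right (Finset.sdiff_subset.trans Finset.sdiff_subset))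
  have c1 := Finset.card_sdiff_add_card_eq_card hV
  have c2 := Finset.card_sdiff_add_card_eq_card hZS
  have c3 := Finset.card_sdiff_add_card_eq_card hW₀
  obtain ⟨V', hV', hV'Z, hle, hge⟩ := hVr (n - W₀.card) (by omega)
  obtain ⟨Z', hZ', hZ'c⟩ := Finset.exists_subset_card_eq
    (show n - W₀.card - V'.card ≤ Z.card by omega)
  have d1 : Disjoint W₀ V' := by
    refine Disjoint.mono hW₀ hV' (Finset.disjoint_union_left.2 ⟨?_, Finset.sdiff_disjoint⟩)
    exact hTS.mono_right (hV.trans Finset.sdiff_subset)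
  have d2 : Disjoint (W₀ ∪ V') Z' := by
    refine Disjoint.mono_right hZ' (Finset.disjoint_union_left.2 ⟨?_, ?_⟩)
    · refine Disjoint.mono_left hW₀ (Finset.disjoint_union_left.2 ⟨hTS.mono_right hZS, ?_⟩)
      exact Finset.sdiff_disjoint.mono_left Finset.sdiff_subset
    · exact Finset.sdiff_disjoint.mono_left (hV'.trans hV)
  have hS₁s : S₁ ⊆ s := Finset.filter_subset _ _
  refine ⟨W₀ ∪ V' ∪ Z', ?_, ?_, (hW₀Z.union d1 hV'Z).union d2 (hZy Z' hZ')⟩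
  · refine Finset.union_subset (Finset.union_subset (hW₀.trans (Finset.union_subset
      (Finset.filter_subset _ _) ?_)) ?_) ((hZ'.trans hZS).trans hS₁s)
    · exact (Finset.sdiff_subset.trans Finset.sdiff_subset).trans hS₁s
    · exact ((hV'.trans hV).trans Finset.sdiff_subset).trans hS₁s
  · rw [Finset.card_union_of_disjoint d2, Finset.card_union_of_disjoint d1, hZ'c]
    omega

/-- A bound for nonempty weighted zero-sum subfamilies gives weighted zero-sum subfamilies of
size exactly `n`. -/
theorem exists_isWeightedSumIn_card_eq (hD : HasDavenportBound ι A D) (hA : A.Nonempty)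
    (x : ι → ZMod n) {s : Finset ι} (hs : s.card + 1 = n + D) (K : AddSubgroup (ZMod n)) :
    ∃ I ⊆ s, I.card = n ∧ IsWeightedSumIn A K x I := by
  classical
  induction K using WellFoundedGT.induction with
  | ind K ih =>
  by_contra hcon
  have hDpos := hD.pos
  let F : ι → Set (ZMod n) := fun i => (· * x i) '' A
  have hFne : ∀ i ∈ s, (F i).Nonempty := fun i _ => hA.image _
  set C := saturation K (setSums F s n) with hC
  have hmemC : ∀ I ⊆ s, I.card = n → ∀ w : ι → ZMod n, (∀ i ∈ I, w i ∈ A) →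
      ∑ i ∈ I, w i * x i ∈ setSums F s n := fun I hI hIn w hw =>
    ⟨I, hI, hIn, fun i => w i * x i, fun i hi => ⟨w i, hw i hi, rfl⟩, rfl⟩
  have hsum : ∀ c ∈ setSums F s n, ∃ I ⊆ s, I.card = n ∧ ∃ w : ι → ZMod n,
      (∀ i ∈ I, w i ∈ A) ∧ ∑ i ∈ I, w i * x i = c := by
    rintro _ ⟨I, hI, hIn, a, ha, rfl⟩
    choose! w hw hwa using ha
    exact ⟨I, hI, hIn, w, hw, Finset.sum_congr rfl hwa⟩
  have hC0 : ∀ g ∈ C, g ∉ K := by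
    rintro g ⟨c, hc, hgc⟩ hg
    obtain ⟨I, hI, hIn, w, hw, rfl⟩ := hsum c hc
    exact hcon ⟨I, hI, hIn, w, hw, by simpa using K.sub_mem hg hgc⟩
  have hper : K = period C := by
    refine (le_period_saturation _ _).eq_of_not_lt fun hlt => ?_
    obtain ⟨I, hI, hIn, w, hw, hwL⟩ := ih _ hlt
    have h1 := mem_of_le_period (y := 0) le_rfl
      (subset_saturation K _ (hmemC I hI hIn w hw)) (by simpa using hwL)
    exact hC0 0 h1 K.zero_mem
  have hmain := truncatedHits_add_card_le hFne (ℓ := n) (by omega) hper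
  have hCK : C.ncard + Nat.card K ≤ n := by
    rw [show Nat.card K = (K : Set (ZMod n)).ncard from Nat.card_coe_set_eq _,
      ← Set.ncard_union_eq (Set.disjoint_left.2 hC0) (Set.toFinite _) (Set.toFinite _)]
    refine (Set.ncard_le_ncard (Set.subset_univ _) (Set.toFinite _)).trans ?_
    rw [Set.ncard_univ, Nat.card_zmod]
  have hhits : ∀ g, cosetHits F s K g ≤ n := by
    intro g
    by_contra hlt
    obtain ⟨I, hI, hIn⟩ := Finset.exists_subset_card_eq (not_le.1 hlt).le
    have hw : ∀ i ∈ I, ∃ a ∈ A, g - a * x i ∈ K := fun i hi => by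
      obtain ⟨_, ⟨a, ha, rfl⟩, h⟩ := (Finset.mem_filter.1 (hI hi)).2
      exact ⟨a, ha, h⟩
    choose! w hw hwK using hw
    refine hcon ⟨I, hI.trans (Finset.filter_subset _ _), hIn, w, hw, ?_⟩
    have := K.sum_mem hwK
    rw [Finset.sum_sub_distrib, Finset.sum_const, hIn] at this
    simpa using this
  have htrunc : truncatedHits F s K n = ∑ i ∈ s, (saturation K (F i)).ncard := by
    unfold truncatedHits
    simp_rw [min_eq_right (hhits _), cosetHits, Finset.card_filter, ← sum_ite_mem_eq_ncard]
    exact Finset.sum_comm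
  set T₀ := s.filter fun i => x i ∉ singleMultiples A K with hT₀
  have hcard : ∀ i ∈ s, Nat.card K * (1 + if x i ∉ singleMultiples A K then 1 else 0) ≤
      (saturation K (F i)).ncard := by
    intro i hi
    by_cases h : x i ∈ singleMultiples A K
    · simpa [h] using card_le_ncard_of_le_period (le_period_saturation K (F i))
        (saturation_nonempty.2 (hFne i hi))
    · rw [if_pos h]
      have : ∃ a ∈ A, ∃ b ∈ A, a * x i - b * x i ∉ K := by
        by_contra! h'
        exact h h'
      obtain ⟨a, ha, b, hb, hab⟩ := this
      have hdisj : Disjoint {g | g - a * x i ∈ K} {g | g - b * x i ∈ K} := by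
        refine Set.disjoint_left.2 fun g hg hg' => hab ?_
        simpa using K.sub_mem hg' hg
      calc Nat.card K * (1 + 1) = ({g | g - a * x i ∈ K} ∪ {g | g - b * x i ∈ K}).ncard := by
            rw [Set.ncard_union_eq hdisj (Set.toFinite _) (Set.toFinite _), ncard_coset,
              ncard_coset]
            ring
        _ ≤ (saturation K (F i)).ncard := by
            refine Set.ncard_le_ncard (Set.union_subset ?_ ?_) (Set.toFinite _)
            · exact fun g hg => ⟨_, ⟨a, ha, rfl⟩, hg⟩
            · exact fun g hg => ⟨_, ⟨b, hb, rfl⟩, hg⟩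
  have hlow : Nat.card K * (s.card + T₀.card) ≤ truncatedHits F s K n := by
    rw [htrunc]
    refine le_trans (le_of_eq ?_) (Finset.sum_le_sum hcard)
    rw [← Finset.mul_sum, Finset.sum_add_distrib, ← Finset.card_filter]
    simp [hT₀]
  have hKpos : 0 < Nat.card K := Nat.card_pos
  refine hcon (exists_isWeightedSumIn_of_few_multiples hD hA x K hs ?_)
  have h1 : Nat.card K * (1 + D + T₀.card) ≤ n := by
    have h2 : Nat.card K * (s.card + 1) = Nat.card K * (n + D) := by rw [hs]
    nlinarith
  calc T₀.card + D + 1 = 1 * (1 + D + T₀.card) := by ring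
    _ ≤ Nat.card K * (1 + D + T₀.card) := Nat.mul_le_mul_right _ hKpos
    _ ≤ n := h1

end WeightedZeroSums

section WeightedSequences

theorem List.Nodup.exists_map_eq {ι β : Type*} [Inhabited β] {l : List ι} (hl : l.Nodup)
    {w : List β} (hw : w.length = l.length) : ∃ u : ι → β, l.map u = w := by
  classical
  refine ⟨fun i => w.getD (l.idxOf i) default, List.ext_getElem (by simp [hw]) fun k h₁ h₂ => ?_⟩
  rw [List.length_map] at h₁
  simp [hl.idxOf_getElem k h₁, h₂]

variable {n : ℕ} {A : Set (ZMod n)}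

theorem isWZSum_map_iff {ι : Type*} [DecidableEq ι] {l : List ι} (hl : l.Nodup)
    (x : ι → ZMod n) : IsWZSum A (l.map x) ↔ IsWeightedSumIn A ⊥ x l.toFinset := by
  have key : ∀ u : ι → ZMod n, (List.zipWith (· * ·) (l.map u) (l.map x)).sum =
      ∑ i ∈ l.toFinset, u i * x i := fun u => by
    rw [List.sum_toFinset _ hl, List.zipWith_map, List.zipWith_self]
  constructor
  · rintro ⟨w, hwl, hw, h0⟩
    obtain ⟨u, rfl⟩ := hl.exists_map_eq (hwl.trans (by simp))
    refine ⟨u, fun i hi => hw _ (List.mem_map_of_mem (List.mem_toFinset.1 hi)), ?_⟩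
    rw [← key, h0]
    exact AddSubgroup.zero_mem _
  · rintro ⟨u, hu, h0⟩
    refine ⟨l.map u, by simp, fun a ha => ?_, (key u).trans h0⟩
    obtain ⟨i, hi, rfl⟩ := List.mem_map.1 ha
    exact hu i (List.mem_toFinset.2 hi)

theorem hasDavenportBound_of_forall_hasWZS {D : ℕ}
    (hD : ∀ S : List (ZMod n), S.length = D → HasWZS A S) (ι : Type*) :
    HasDavenportBound ι A D := by
  classical
  intro S x hS
  obtain ⟨S', hS', hc⟩ := Finset.exists_subset_card_eq hS
  obtain ⟨T, hT, hTne, hT0⟩ := hD (S'.toList.map x) (by simp [hc])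
  obtain ⟨l, hl, rfl⟩ := List.sublist_map_iff.1 hT
  refine ⟨l.toFinset, fun i hi => hS' ?_, ?_,
    (isWZSum_map_iff (hl.nodup S'.nodup_toList) x).1 hT0⟩
  · exact Finset.mem_toList.1 (hl.subset (List.mem_toFinset.1 hi))
  · rw [List.toFinset_nonempty_iff]
    rintro rfl
    exact hTne rfl

theorem hasWZSS_of_isWeightedSumIn {S : List (ZMod n)} {I : Finset (Fin S.length)} {t : ℕ}
    (ht : 0 < t) (hI : I.card = t) (h : IsWeightedSumIn A ⊥ S.get I) : HasWZSS A S t := by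
  set l := (List.finRange S.length).filter (· ∈ I)
  have hl : l.Nodup := (List.nodup_finRange _).filter _
  have hlI : l.toFinset = I := by ext; simp [l]
  refine ⟨ht, l.map S.get, ?_, ?_, (isWZSum_map_iff hl _).2 (hlI ▸ h)⟩
  · have := (List.filter_sublist (p := (· ∈ I)) (l := List.finRange S.length)).map S.get
    rwa [List.map_get_finRange] at this
  · rw [List.length_map, ← List.toFinset_card_of_nodup hl, hlI, hI]

theorem hasWZS_of_length_eq [NeZero n] (hA : A.Nonempty) {S : List (ZMod n)}
    (hS : S.length = n) : HasWZS A S := by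
  obtain ⟨a, ha⟩ := hA
  obtain ⟨i, j, hij, hsum⟩ : ∃ i j : Fin (n + 1), i < j ∧ (S.take i).sum = (S.take j).sum := by
    obtain ⟨i, j, hij, h⟩ := Fintype.exists_ne_map_eq_of_card_lt
      (fun i : Fin (n + 1) => (S.take i).sum) (by simp)
    rcases lt_or_gt_of_ne hij with hlt | hlt
    · exact ⟨i, j, hlt, h⟩
    · exact ⟨j, i, hlt, h.symm⟩
  have hij' : (i : ℕ) < j := hij
  set T := (S.take j).drop i with hT
  have hT0 : T.sum = 0 := by
    have := List.sum_take_add_sum_drop (S.take j) i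
    rw [List.take_take, min_eq_left hij'.le, hsum] at this
    simpa using this
  refine ⟨T, (List.drop_sublist _ _).trans (List.take_sublist _ _), ?_,
    List.replicate T.length a, by simp, fun b hb => List.eq_of_mem_replicate hb ▸ ha, ?_⟩
  · refine List.length_pos_iff.1 ?_
    have := j.is_lt
    simp only [hT, List.length_drop, List.length_take]
    omega
  · rw [← List.map_const', List.zipWith_map_left, List.zipWith_self, List.sum_map_mul_left]
    simp [hT0]

theorem hasWZS_of_hasWZSS_append_replicate_zero {S : List (ZMod n)} {m t : ℕ} (hmt : m < t)
    (h : HasWZSS A (S ++ List.replicate m 0) t) : HasWZS A S := by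
  obtain ⟨-, T, hT, hTt, w, hwl, hw, h0⟩ := h
  obtain ⟨T₁, T₂, rfl, hT₁, hT₂⟩ := List.sublist_append_iff.1 hT
  obtain ⟨k, hk, rfl⟩ := List.sublist_replicate_iff.1 hT₂
  simp only [List.length_append, List.length_replicate] at hTt hwl
  have hw₁ : (w.take T₁.length).length = T₁.length := by simp; omega
  refine ⟨T₁, hT₁, List.length_pos_iff.1 (by omega), w.take T₁.length, hw₁,
    fun a ha => hw a (List.mem_of_mem_take ha), ?_⟩
  rw [← List.take_append_drop T₁.length w, List.zipWith_append hw₁, List.sum_append] at h0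
  have hz : (List.zipWith (· * ·) (w.drop T₁.length) (List.replicate k (0 : ZMod n))).sum = 0 := by
    refine List.sum_eq_zero fun c hc => ?_
    obtain ⟨j, hj, rfl⟩ := List.getElem_of_mem hc
    simp
  rwa [hz, add_zero] at h0

theorem davC_spec [NeZero n] (hA : A.Nonempty) :
    0 < DavC n A ∧ ∀ S : List (ZMod n), S.length = DavC n A → HasWZS A S :=
  Nat.sInf_mem (s := {k | 0 < k ∧ ∀ S : List (ZMod n), S.length = k → HasWZS A S})
    ⟨n, NeZero.pos n, fun _ => hasWZS_of_length_eq hA⟩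

end WeightedSequences

/-- For `n ≥ 2` and `A` a nonempty subset of `ZMod n`, `E_A(n) = D_A(n) + n - 1`. -/
theorem gao_eq_davenport_add (n : ℕ) (hn : 2 ≤ n) (A : Set (ZMod n)) (hA : A.Nonempty) :
    GaoC n A = DavC n A + n - 1 := by
  have : NeZero n := ⟨by omega⟩
  obtain ⟨hpos, hD⟩ := davC_spec hA
  have hmem : DavC n A + n - 1 ∈
      {k | 0 < k ∧ ∀ S : List (ZMod n), S.length = k → HasWZSS A S n} := by
    refine ⟨by omega, fun S hS => ?_⟩
    obtain ⟨I, -, hI, h⟩ := exists_isWeightedSumIn_card_eq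
      (hasDavenportBound_of_forall_hasWZS hD (Fin S.length)) hA S.get (s := Finset.univ)
      (by rw [Finset.card_univ, Fintype.card_fin]; omega) ⊥
    exact hasWZSS_of_isWeightedSumIn (by omega) hI h
  refine le_antisymm (Nat.sInf_le hmem) (le_csInf ⟨_, hmem⟩ ?_)
  rintro k ⟨-, hk⟩
  have hnk : n ≤ k := by
    obtain ⟨-, T, hT, hTn, -⟩ := hk (List.replicate k 0) (by simp)
    simpa [hTn] using hT.length_le
  have hle : DavC n A ≤ k - (n - 1) := by
    refine Nat.sInf_le ⟨by omega, fun S hS => ?_⟩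
    refine hasWZS_of_hasWZSS_append_replicate_zero (m := n - 1) (t := n) (by omega) (hk _ ?_)
    simp only [List.length_append, List.length_replicate, hS]
    omega
  omega
end

section
/- For every integer n ≥ 2, E_{U(n)}(n) = n + Ω(n), where Ω(n) is the number of prime factors of n counted with multiplicity. -/
open Finset

section Hypergraph

variable {ι κ : Type*} [DecidableEq ι]

/-- The number of points of `D` minus the number of hyperedges contained in `D`. -/
def surplus (J : Finset κ) (H : κ → Finset ι) (D : Finset ι) : ℤ :=
  (#D : ℤ) - #{j ∈ J | H j ⊆ D}

/-- No hyperedge has exactly one point outside `D`. -/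
def IsHyperclosed (J : Finset κ) (H : κ → Finset ι) (D : Finset ι) : Prop :=
  ∀ j ∈ J, #(H j \ D) ≠ 1

variable (J : Finset κ) (H : κ → Finset ι)

theorem card_le_of_surplus_le {D : Finset ι} {k : ℤ} (h : surplus J H D ≤ k) :
    (#D : ℤ) ≤ k + #J := by
  have := card_filter_le J (fun j => H j ⊆ D)
  unfold surplus at h
  omega

theorem surplus_inter_add_surplus_union_le (D E : Finset ι) :
    surplus J H (D ∩ E) + surplus J H (D ∪ E) ≤ surplus J H D + surplus J H E := by
  classical
  have h₁ := card_union_add_card_inter D E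
  have h₂ := card_union_add_card_inter {j ∈ J | H j ⊆ D} {j ∈ J | H j ⊆ E}
  have h₃ : #({j ∈ J | H j ⊆ D} ∪ {j ∈ J | H j ⊆ E}) ≤ #{j ∈ J | H j ⊆ D ∪ E} := by
    apply card_le_card
    intro j hj
    simp only [mem_union, mem_filter] at hj ⊢
    rcases hj with hj | hj
    · exact ⟨hj.1, hj.2.trans subset_union_left⟩
    · exact ⟨hj.1, hj.2.trans subset_union_right⟩
  have h₄ : {j ∈ J | H j ⊆ D} ∩ {j ∈ J | H j ⊆ E} = {j ∈ J | H j ⊆ D ∩ E} := by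
    ext j
    simp only [mem_inter, mem_filter, subset_inter_iff]
    tauto
  rw [h₄] at h₂
  unfold surplus
  omega

theorem surplus_insert_le {D : Finset ι} {x : ι} (hx : x ∉ D) :
    surplus J H (insert x D) ≤ surplus J H D + 1 := by
  have h : #{j ∈ J | H j ⊆ D} ≤ #{j ∈ J | H j ⊆ insert x D} :=
    card_le_card <| monotone_filter_right _ fun j _ hj => hj.trans (subset_insert x D)
  unfold surplus
  rw [card_insert_of_notMem hx]
  push_cast
  omega

theorem surplus_insert_le_of_sdiff_eq_singleton {D : Finset ι} {x : ι} {j : κ} (hj : j ∈ J)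
    (h : H j \ D = {x}) : surplus J H (insert x D) ≤ surplus J H D := by
  have hx : x ∈ H j ∧ x ∉ D := mem_sdiff.1 (h ▸ mem_singleton_self x)
  have h : #{j ∈ J | H j ⊆ D} < #{j ∈ J | H j ⊆ insert x D} := by
    apply card_lt_card
    rw [ssubset_iff_of_subset
      (monotone_filter_right _ fun j _ hj => hj.trans (subset_insert x D))]
    refine ⟨j, mem_filter.2 ⟨hj, ?_⟩, fun h' => hx.2 ((mem_filter.1 h').2 hx.1)⟩
    rw [insert_eq, ← h]
    intro y hy
    by_cases hyD : y ∈ D <;> simp [hy, hyD]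
  unfold surplus
  rw [card_insert_of_notMem hx.2]
  push_cast
  omega

/-- A set that cannot be enlarged without increasing its surplus is closed. -/
theorem isHyperclosed_of_insert {D : Finset ι}
    (h : ∀ x ∉ D, surplus J H D < surplus J H (insert x D)) : IsHyperclosed J H D := by
  intro j hj hc
  obtain ⟨x, hx⟩ := card_eq_one.1 hc
  have hxD : x ∉ D := (mem_sdiff.1 (hx ▸ mem_singleton_self x)).2
  exact (surplus_insert_le_of_sdiff_eq_singleton J H hj hx).not_gt (h x hxD)

variable [Fintype ι]

theorem exists_isHyperclosed_surplus_le (B : Finset ι) :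
    ∃ D, B ⊆ D ∧ IsHyperclosed J H D ∧ surplus J H D ≤ surplus J H B := by
  classical
  obtain ⟨D, hD, hmax⟩ := exists_max_image
    {D : Finset ι | B ⊆ D ∧ surplus J H D ≤ surplus J H B} card ⟨B, by simp⟩
  simp only [mem_filter, mem_univ, true_and] at hD hmax
  refine ⟨D, hD.1, isHyperclosed_of_insert J H fun x hx => ?_, hD.2⟩
  by_contra! h
  have := hmax (insert x D) ⟨hD.1.trans (subset_insert _ _), h.trans hD.2⟩
  rw [card_insert_of_notMem hx] at this
  omega

/-- At the cost of one more unit of surplus, a closed set can be chosen to leave an even number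
of points of a given set `Q` uncovered. -/
theorem exists_isHyperclosed_even_sdiff (B Q : Finset ι) :
    ∃ D, B ⊆ D ∧ IsHyperclosed J H D ∧ surplus J H D ≤ surplus J H B + 1 ∧
      Even #(Q \ D) := by
  classical
  obtain ⟨C, hC, hmin⟩ := exists_min_image
    {D : Finset ι | B ⊆ D} (surplus J H) ⟨B, by simp⟩
  obtain ⟨D₀, hD₀, hmax⟩ := exists_max_image
    {D : Finset ι | B ⊆ D ∧ surplus J H D ≤ surplus J H C} card
    ⟨C, by simpa using hC⟩
  simp only [mem_filter, mem_univ, true_and] at hC hmin hD₀ hmax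
  have hlt : ∀ D, D₀ ⊂ D → surplus J H D₀ < surplus J H D := by
    intro D hD
    by_contra! h
    exact (hmax D ⟨hD₀.1.trans hD.1, h.trans hD₀.2⟩).not_gt (card_lt_card hD)
  have hB : surplus J H D₀ ≤ surplus J H B := hD₀.2.trans (hmin B subset_rfl)
  by_cases hev : Even #(Q \ D₀)
  · exact ⟨D₀, hD₀.1, isHyperclosed_of_insert J H fun x hx => hlt _ (ssubset_insert hx),
      by omega, hev⟩
  -- The maximal sets of surplus one more than the minimum partition the complement of `D₀`.
  have hcls : ∀ x, ∃ D, x ∉ D₀ → (D₀ ⊆ D ∧ x ∈ D ∧ surplus J H D ≤ surplus J H D₀ + 1 ∧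
      ∀ E, D₀ ⊆ E → surplus J H E ≤ surplus J H D₀ + 1 → ¬ Disjoint (D \ D₀) E → E ⊆ D) := by
    intro x
    by_cases hx : x ∈ D₀
    · exact ⟨∅, fun h => absurd hx h⟩
    obtain ⟨D, hD, hDmax⟩ := exists_max_image
      {D : Finset ι | D₀ ⊆ D ∧ x ∈ D ∧ surplus J H D ≤ surplus J H D₀ + 1} card
      ⟨insert x D₀, by simpa using surplus_insert_le J H hx⟩
    simp only [mem_filter, mem_univ, true_and] at hD hDmax
    refine ⟨D, fun _ => ⟨hD.1, hD.2.1, hD.2.2, fun E hE hsE hdis => ?_⟩⟩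
    obtain ⟨y, hyD, hyE⟩ := not_disjoint_iff.1 hdis
    rw [mem_sdiff] at hyD
    have h₁ := surplus_inter_add_surplus_union_le J H D E
    have h₂ := hlt (D ∩ E) ((ssubset_iff_of_subset (subset_inter hD.1 hE)).2
      ⟨y, mem_inter.2 ⟨hyD.1, hyE⟩, hyD.2⟩)
    have h₃ := hDmax (D ∪ E) ⟨hD.1.trans subset_union_left, mem_union_left _ hD.2.1, by omega⟩
    exact (eq_of_subset_of_card_le subset_union_left h₃) ▸ subset_union_right
  choose c hc using hcls
  have hfib : ∀ x ∉ D₀, ∀ y ∉ D₀, (c y = c x ↔ y ∈ c x) := by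
    intro x hx y hy
    obtain ⟨hx₁, hx₂, hx₃, hx₄⟩ := hc x hx
    obtain ⟨hy₁, hy₂, hy₃, hy₄⟩ := hc y hy
    refine ⟨fun h => h ▸ hy₂, fun h => subset_antisymm ?_ ?_⟩
    · exact hx₄ _ hy₁ hy₃ (not_disjoint_iff.2 ⟨y, mem_sdiff.2 ⟨h, hy⟩, hy₂⟩)
    · exact hy₄ _ hx₁ hx₃ (not_disjoint_iff.2 ⟨y, mem_sdiff.2 ⟨hy₂, hy⟩, h⟩)
  obtain ⟨D, hDim, hDodd⟩ : ∃ D ∈ (Q \ D₀).image c, ¬ Even #{y ∈ Q \ D₀ | c y = D} := by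
    by_contra! h
    rw [card_eq_sum_card_image c] at hev
    exact hev (even_sum _ h)
  obtain ⟨x, hx, rfl⟩ := mem_image.1 hDim
  have hx := (mem_sdiff.1 hx).2
  obtain ⟨hx₁, hx₂, hx₃, hx₄⟩ := hc x hx
  refine ⟨c x, hD₀.1.trans hx₁, isHyperclosed_of_insert J H fun z hz => ?_, by omega, ?_⟩
  · by_contra! h
    refine hz (hx₄ _ (hx₁.trans (subset_insert z _)) (h.trans hx₃) ?_ (mem_insert_self z _))
    exact not_disjoint_iff.2 ⟨x, mem_sdiff.2 ⟨hx₂, hx⟩, mem_insert_of_mem hx₂⟩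
  · have h₁ : {y ∈ Q \ D₀ | c y = c x} = {y ∈ Q \ D₀ | y ∈ c x} :=
      filter_congr fun y hy => hfib x hx y (mem_sdiff.1 hy).2
    have h₂ : {y ∈ Q \ D₀ | y ∉ c x} = Q \ c x := by
      ext y
      simp only [mem_filter, mem_sdiff]
      exact ⟨fun h => ⟨h.1.1, h.2⟩, fun h => ⟨⟨h.1, fun h' => h.2 (hx₁ h')⟩, h.2⟩⟩
    have h₃ := card_filter_add_card_filter_not (s := Q \ D₀) (fun y => y ∈ c x)
    rw [h₁] at hDodd
    rw [h₂] at h₃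
    grind

end Hypergraph

section UnitZeroSum

variable {ι : Type*}

/-- Some weights coprime to `m` make the weighted sum of `x` over `M` divisible by `m`. -/
def UnitZeroSum (m : ℕ) (M : Finset ι) (x : ι → ℕ) : Prop :=
  ∃ w : ι → ℕ, (∀ i, (w i).Coprime m) ∧ m ∣ ∑ i ∈ M, w i * x i

theorem unitZeroSum_of_forall_dvd {m : ℕ} {M : Finset ι} {x : ι → ℕ} (h : ∀ i ∈ M, m ∣ x i) :
    UnitZeroSum m M x :=
  ⟨fun _ => 1, fun _ => Nat.coprime_one_left m, dvd_sum fun i hi => (h i hi).mul_left _⟩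

theorem UnitZeroSum.mul {a b : ℕ} {M : Finset ι} {x : ι → ℕ} (hab : a.Coprime b)
    (ha : UnitZeroSum a M x) (hb : UnitZeroSum b M x) : UnitZeroSum (a * b) M x := by
  obtain ⟨u, hu, hua⟩ := ha
  obtain ⟨v, hv, hvb⟩ := hb
  let w (i : ι) := Nat.chineseRemainder hab (u i) (v i)
  refine ⟨fun i => w i, fun i => ?_, hab.mul_dvd_of_dvd_of_dvd ?_ ?_⟩
  · refine Nat.Coprime.mul_right ?_ ?_
    · exact (w i).2.1.gcd_eq.trans (hu i)
    · exact (w i).2.2.gcd_eq.trans (hv i)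
  · refine (Nat.ModEq.dvd_iff (Nat.ModEq.sum fun i _ => ?_) dvd_rfl).2 hua
    exact (w i).2.1.mul_right _
  · refine (Nat.ModEq.dvd_iff (Nat.ModEq.sum fun i _ => ?_) dvd_rfl).2 hvb
    exact (w i).2.2.mul_right _

theorem unitZeroSum_of_forall_prime {m : ℕ} (hm : m ≠ 0) {M : Finset ι} {x : ι → ℕ}
    (h : ∀ p ∈ m.primeFactors, UnitZeroSum (p ^ m.factorization p) M x) :
    UnitZeroSum m M x := by
  induction m using Nat.recOnPosPrimePosCoprime with
  | zero => exact absurd rfl hm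
  | one => exact unitZeroSum_of_forall_dvd fun i _ => one_dvd _
  | prime_pow p k hp hk =>
    have := h p (by simp [Nat.primeFactors_prime_pow hk.ne' hp])
    simpa [hp.factorization_pow] using this
  | coprime a b ha hb hab iha ihb =>
    refine UnitZeroSum.mul hab (iha (by omega) fun p hp => ?_) (ihb (by omega) fun p hp => ?_)
    · rw [← Nat.factorization_eq_of_coprime_left hab
        (Nat.mem_primeFactors_iff_mem_primeFactorsList.1 hp)]
      exact h p (by rw [hab.primeFactors_mul]; exact mem_union_left _ hp)
    · rw [← Nat.factorization_eq_of_coprime_right hab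
        (Nat.mem_primeFactors_iff_mem_primeFactorsList.1 hp)]
      exact h p (by rw [hab.primeFactors_mul]; exact mem_union_right _ hp)

theorem exists_coprime_dvd_mul_add {p k y c : ℕ} (hp : p.Prime) (hk : k ≠ 0) (hy : ¬ p ∣ y)
    (hc : ¬ p ∣ c) : ∃ w : ℕ, w.Coprime (p ^ k) ∧ p ^ k ∣ w * y + c := by
  have : NeZero (p ^ k) := ⟨pow_ne_zero _ hp.ne_zero⟩
  have hyc : y.Coprime (p ^ k) := ((Nat.Prime.coprime_iff_not_dvd hp).2 hy).symm.pow_right k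
  let w : ℕ := (-(c : ZMod (p ^ k)) * (y : ZMod (p ^ k))⁻¹).val
  have hw : p ^ k ∣ w * y + c := by
    rw [← ZMod.natCast_eq_zero_iff]
    push_cast
    rw [ZMod.natCast_zmod_val, mul_assoc, mul_comm _ (y : ZMod (p ^ k)),
      ZMod.coe_mul_inv_eq_one y hyc]
    ring
  refine ⟨w, (((Nat.Prime.coprime_iff_not_dvd hp).2 fun h => hc ?_).symm.pow_right k), hw⟩
  exact (Nat.dvd_add_right (h.mul_right y)).1 ((dvd_pow_self p hk).trans hw)

theorem exists_eq_pow_mul {p e : ℕ} {M : Finset ι} {x : ι → ℕ} (hp : p.Prime)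
    (hdvd : ∀ i ∈ M, p ^ e ∣ x i) :
    ∃ y : ι → ℕ, ∀ i ∈ M, x i = p ^ e * y i ∧ (p ^ (e + 1) ∣ x i ↔ p ∣ y i) := by
  refine ⟨fun i => x i / p ^ e, fun i hi => ?_⟩
  have h := (Nat.mul_div_cancel' (hdvd i hi)).symm
  refine ⟨h, ?_⟩
  conv_lhs => rw [h, pow_succ]
  exact Nat.mul_dvd_mul_iff_left (pow_pos hp.pos e)

variable [DecidableEq ι]

/-- If all terms are divisible by `p ^ e` and the partial weighted sum omitting a term of exact
valuation `e` has exact valuation `e`, then the omitted term can be used to reach zero. -/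
theorem unitZeroSum_prime_pow {p k e : ℕ} (hp : p.Prime) (hek : e < k) {M : Finset ι}
    {x y : ι → ℕ} (hxy : ∀ i ∈ M, x i = p ^ e * y i) {j : ι} (hj : j ∈ M) (hyj : ¬ p ∣ y j) (w : ι → ℕ)
    (hw : ∀ i, (w i).Coprime p) (hsum : ¬ p ∣ ∑ i ∈ M.erase j, w i * y i) :
    UnitZeroSum (p ^ k) M x := by
  obtain ⟨v, hv, hvd⟩ :=
    exists_coprime_dvd_mul_add hp (Nat.sub_ne_zero_of_lt hek) hyj hsum
  refine ⟨Function.update w j v, fun i => Nat.Coprime.pow_right k ?_, ?_⟩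
  · by_cases hij : i = j
    · subst hij
      simpa using hv.coprime_dvd_right (dvd_pow_self p (Nat.sub_ne_zero_of_lt hek))
    · simpa [hij] using hw i
  · have h : ∑ i ∈ M, Function.update w j v i * x i
        = p ^ e * (v * y j + ∑ i ∈ M.erase j, w i * y i) := by
      rw [← add_sum_erase _ _ hj, hxy j hj, mul_add, mul_sum, Function.update_self]
      congr 1
      · ring
      · refine sum_congr rfl fun i hi => ?_
        rw [Function.update_of_ne (ne_of_mem_erase hi), hxy i (mem_of_mem_erase hi)]
        ring
    rw [h, ← Nat.add_sub_cancel' hek.le, pow_add]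
    exact mul_dvd_mul_left _ hvd

theorem unitZeroSum_odd_prime_pow {p k e : ℕ} (hp : p.Prime) (hp2 : p ≠ 2) (hek : e < k)
    {M : Finset ι} {x : ι → ℕ} (hdvd : ∀ i ∈ M, p ^ e ∣ x i) {i j : ι} (hi : i ∈ M) (hj : j ∈ M)
    (hij : i ≠ j) (hxi : ¬ p ^ (e + 1) ∣ x i) (hxj : ¬ p ^ (e + 1) ∣ x j) :
    UnitZeroSum (p ^ k) M x := by
  obtain ⟨y, hy⟩ := exists_eq_pow_mul hp hdvd
  rw [(hy i hi).2] at hxi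
  rw [(hy j hj).2] at hxj
  have hiM : i ∈ M.erase j := mem_erase.2 ⟨hij, hi⟩
  by_cases hs : p ∣ ∑ i ∈ M.erase j, 1 * y i
  · refine unitZeroSum_prime_pow hp hek (fun i hi => (hy i hi).1) hj hxj
      (Function.update (fun _ => 1) i 2) (fun l => ?_) fun hs' => hxi ?_
    · by_cases hl : l = i
      · subst hl
        simpa using (Nat.coprime_primes Nat.prime_two hp).2 hp2.symm
      · simp [hl]
    · have h : ∑ l ∈ M.erase j, Function.update (fun _ => 1) i 2 l * y l
          = (∑ l ∈ M.erase j, 1 * y l) + y i := by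
        rw [← add_sum_erase _ _ hiM, ← add_sum_erase _ (fun l => 1 * y l) hiM,
          Function.update_self]
        have : ∀ l ∈ (M.erase j).erase i, Function.update (fun _ => 1) i 2 l * y l = 1 * y l :=
          fun l hl => by rw [Function.update_of_ne (ne_of_mem_erase hl)]
        rw [sum_congr rfl this]
        ring
      rw [h] at hs'
      exact (Nat.dvd_add_right hs).1 hs'
  · exact unitZeroSum_prime_pow hp hek (fun i hi => (hy i hi).1) hj hxj (fun _ => 1)
      (fun _ => Nat.coprime_one_left p) hs

theorem unitZeroSum_two_pow {k e : ℕ} (hek : e < k) {M : Finset ι} {x : ι → ℕ}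
    (hdvd : ∀ i ∈ M, 2 ^ e ∣ x i) (hne : {i ∈ M | ¬ 2 ^ (e + 1) ∣ x i}.Nonempty)
    (heven : Even #{i ∈ M | ¬ 2 ^ (e + 1) ∣ x i}) :
    UnitZeroSum (2 ^ k) M x := by
  obtain ⟨y, hy⟩ := exists_eq_pow_mul Nat.prime_two hdvd
  obtain ⟨j, hj⟩ := hne
  rw [mem_filter] at hj
  have hyj : ¬ 2 ∣ y j := by rw [← (hy j hj.1).2]; exact hj.2
  have hfil : {i ∈ M | ¬ 2 ^ (e + 1) ∣ x i} = {i ∈ M | Odd (y i)} :=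
    filter_congr fun i hi => by rw [(hy i hi).2, ← even_iff_two_dvd, Nat.not_even_iff_odd]
  have hs : Even (∑ i ∈ M, y i) := by
    rw [← Nat.not_odd_iff_even, odd_sum_iff_odd_card_odd, ← hfil, Nat.not_odd_iff_even]
    exact heven
  refine unitZeroSum_prime_pow Nat.prime_two hek (fun i hi => (hy i hi).1) hj.1 hyj (fun _ => 1)
    (fun _ => Nat.coprime_one_left 2) fun h => hyj ?_
  rw [← add_sum_erase _ _ hj.1] at hs
  simp only [one_mul] at h
  exact (Nat.dvd_add_left h).1 hs.two_dvd

end UnitZeroSum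

section Selection

variable {ι : Type*} [Fintype ι]

/-- The indices of the terms of `x` that are not divisible by `m`. -/
def nonMultiples (x : ι → ℕ) (m : ℕ) : Finset ι := {i | ¬ m ∣ x i}

theorem mem_nonMultiples {x : ι → ℕ} {m : ℕ} {i : ι} : i ∈ nonMultiples x m ↔ ¬ m ∣ x i := by
  simp [nonMultiples]

/-- The pairs `(p, e)` with `p` an odd prime such that `p ^ (e + 1)` divides `n`. -/
def oddPrimePowers (n : ℕ) : Finset (Σ _ : ℕ, ℕ) :=
  (n.primeFactors.erase 2).sigma fun p => range (n.factorization p)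

theorem card_oddPrimePowers_add (n : ℕ) :
    #(oddPrimePowers n) + n.factorization 2 = (Nat.primeFactorsList n).length := by
  have h : (Nat.primeFactorsList n).length = ∑ p ∈ n.primeFactors, n.factorization p := by
    rw [← ArithmeticFunction.cardFactors_apply,
      ArithmeticFunction.cardFactors_eq_sum_factorization]
    rfl
  rw [h, oddPrimePowers, card_sigma]
  simp only [card_range]
  by_cases h2 : 2 ∈ n.primeFactors
  · rw [sum_erase_add _ _ h2]
  · rw [erase_eq_of_notMem h2, ← Nat.support_factorization, Finsupp.notMem_support_iff] at *
    omega

theorem two_mul_card_add_one_le_prod (n : ℕ) :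
    2 * #(n.primeFactors.erase 2) + 1 ≤ ∏ p ∈ n.primeFactors.erase 2, p := by
  have h₁ : 3 ^ #(n.primeFactors.erase 2) ≤ ∏ p ∈ n.primeFactors.erase 2, p := by
    refine pow_card_le_prod _ _ _ fun p hp => ?_
    rw [mem_erase] at hp
    have := (Nat.prime_of_mem_primeFactors hp.2).two_le
    omega
  have h₂ := one_add_mul_le_pow (R := ℤ) (a := 2) (by norm_num) #(n.primeFactors.erase 2)
  norm_num at h₂
  have h₃ : 1 + #(n.primeFactors.erase 2) * 2 ≤ 3 ^ #(n.primeFactors.erase 2) := by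
    exact_mod_cast h₂
  omega

theorem two_mul_card_add_one_le {n : ℕ} (hn : n ≠ 0) :
    2 * #(n.primeFactors.erase 2) + 1 ≤ n :=
  (two_mul_card_add_one_le_prod n).trans <| Nat.le_of_dvd (Nat.pos_of_ne_zero hn) <|
    (prod_dvd_prod_of_subset _ _ _ (erase_subset 2 _)).trans (Nat.prod_primeFactors_dvd n)

theorem four_mul_card_add_two_le {n : ℕ} (hn : n ≠ 0) (h2 : 2 ∣ n) :
    4 * #(n.primeFactors.erase 2) + 2 ≤ n := by
  have h₁ := two_mul_card_add_one_le_prod n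
  have h₂ := Nat.le_of_dvd (Nat.pos_of_ne_zero hn) (Nat.prod_primeFactors_dvd n)
  rw [← mul_prod_erase n.primeFactors _ (Nat.prime_two.mem_primeFactors h2 hn)] at h₂
  omega

variable [DecidableEq ι]

theorem exists_core_prime {n p : ℕ} {x : ι → ℕ} {D : Finset ι}
    (hD : IsHyperclosed (oddPrimePowers n) (fun j => nonMultiples x (j.1 ^ (j.2 + 1))) D)
    (hp : p ∈ n.primeFactors.erase 2) :
    ∃ T, Disjoint T D ∧ #T ≤ 2 ∧ ∀ M, T ⊆ M → Disjoint M D →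
      UnitZeroSum (p ^ n.factorization p) M x := by
  have hpp := mem_erase.1 hp
  have hprime := Nat.prime_of_mem_primeFactors hpp.2
  by_cases hall : ∀ e < n.factorization p, nonMultiples x (p ^ (e + 1)) ⊆ D
  · refine ⟨∅, disjoint_empty_left _, by simp, fun M _ hM => unitZeroSum_of_forall_dvd ?_⟩
    intro i hi
    rcases Nat.eq_zero_or_pos (n.factorization p) with h0 | hpos
    · simp [h0]
    have := hall (n.factorization p - 1) (by omega)
    rw [Nat.sub_add_cancel hpos] at this
    by_contra h
    exact disjoint_left.1 hM hi (this (mem_nonMultiples.2 h))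
  · push Not at hall
    classical
    obtain ⟨he, hsub⟩ := Nat.find_spec hall
    have hmin := fun m => Nat.find_min hall (m := m)
    set e := Nat.find hall
    have hne : (nonMultiples x (p ^ (e + 1)) \ D).Nonempty := sdiff_nonempty.2 hsub
    have hone : #(nonMultiples x (p ^ (e + 1)) \ D) ≠ 1 :=
      hD ⟨p, e⟩ (mem_sigma.2 ⟨hp, mem_range.2 he⟩)
    have htwo : 1 < #(nonMultiples x (p ^ (e + 1)) \ D) := by
      have := hne.card_pos
      omega
    obtain ⟨i, hi, j, hj, hij⟩ := one_lt_card.1 htwo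
    rw [mem_sdiff, mem_nonMultiples] at hi hj
    refine ⟨{i, j}, ?_, card_le_two, fun M hTM hM => ?_⟩
    · simp [hi.2, hj.2]
    refine unitZeroSum_odd_prime_pow hprime hpp.1 he (fun l hl => ?_) (hTM (by simp))
      (hTM (by simp)) hij hi.1 hj.1
    rcases Nat.eq_zero_or_pos e with h0 | hpos
    · simp [h0]
    by_contra h
    refine hmin (e - 1) (by omega) ⟨by omega, fun hs => ?_⟩
    rw [Nat.sub_add_cancel hpos] at hs
    exact disjoint_left.1 hM hl (hs (mem_nonMultiples.2 h))

theorem exists_core {n : ℕ} (hn : n ≠ 0) {x : ι → ℕ} {D : Finset ι}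
    (hD : IsHyperclosed (oddPrimePowers n) (fun j => nonMultiples x (j.1 ^ (j.2 + 1))) D) :
    ∃ T, T ⊆ Dᶜ ∧ #T ≤ 2 * #(n.primeFactors.erase 2) ∧ ∀ M, T ⊆ M → M ⊆ Dᶜ →
      UnitZeroSum (2 ^ n.factorization 2) M x → UnitZeroSum n M x := by
  choose! T hTD hT2 hT using fun p hp => exists_core_prime (p := p) hD hp
  refine ⟨(n.primeFactors.erase 2).biUnion T, ?_, ?_, fun M hTM hMD h2 => ?_⟩
  · exact biUnion_subset.2 fun p hp => subset_compl_iff_disjoint_right.2 (hTD p hp)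
  · rw [mul_comm]
    exact card_biUnion_le_card_mul _ _ _ hT2
  · refine unitZeroSum_of_forall_prime hn fun p hp => ?_
    by_cases hp2 : p = 2
    · exact hp2 ▸ h2
    · have hp' := mem_erase.2 ⟨hp2, hp⟩
      exact hT p hp' M ((subset_biUnion_of_mem T hp').trans hTM)
        (subset_compl_iff_disjoint_right.1 hMD)

/-- Either the terms of exact `2`-adic valuation `e` can be balanced, or they can all be discarded
within the allowance. -/
theorem exists_unitZeroSum_or_exists_surplus_le {n e : ℕ} (hn : n ≠ 0) {x : ι → ℕ}
    (hcard : Fintype.card ι = n + (Nat.primeFactorsList n).length)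
    (he : e < n.factorization 2) {B : Finset ι} (hB : nonMultiples x (2 ^ e) ⊆ B)
    (hsB : surplus (oddPrimePowers n) (fun j => nonMultiples x (j.1 ^ (j.2 + 1))) B ≤ e) :
    (∃ M : Finset ι, #M = n ∧ UnitZeroSum n M x) ∨
    ∃ D, nonMultiples x (2 ^ (e + 1)) ⊆ D ∧
      surplus (oddPrimePowers n) (fun j => nonMultiples x (j.1 ^ (j.2 + 1))) D ≤ e + 1 := by
  have h2n : 2 ∣ n := Nat.dvd_of_factorization_pos (by omega)
  have hbig := four_mul_card_add_two_le hn h2n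
  have hΩ := card_oddPrimePowers_add n
  set r := #(n.primeFactors.erase 2)
  set J := oddPrimePowers n
  set H : (Σ _ : ℕ, ℕ) → Finset ι := fun j => nonMultiples x (j.1 ^ (j.2 + 1))
  obtain ⟨D₀, hBD₀, hD₀, hsD₀⟩ := exists_isHyperclosed_surplus_le J H B
  have hdvd : ∀ M : Finset ι, M ⊆ D₀ᶜ → ∀ i ∈ M, 2 ^ e ∣ x i := by
    intro M hM i hi
    by_contra h
    exact (mem_compl.1 (hM hi)) (hBD₀ (hB (mem_nonMultiples.2 h)))
  set O := nonMultiples x (2 ^ (e + 1)) \ D₀ with hO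
  set E := D₀ᶜ \ nonMultiples x (2 ^ (e + 1)) with hE
  have hfilter : ∀ M : Finset ι, {i ∈ M | ¬ 2 ^ (e + 1) ∣ x i}
      = {i ∈ M | i ∈ nonMultiples x (2 ^ (e + 1))} :=
    fun M => filter_congr fun i _ => mem_nonMultiples.symm
  by_cases hsmall : ∃ Q, (Q = O ∨ Q = E) ∧ #Q ≤ 2 * r + 1
  · obtain ⟨Q, hQ, hQr⟩ := hsmall
    obtain ⟨D, hDD, hD, hsD, hev⟩ := exists_isHyperclosed_even_sdiff J H D₀ Q
    have hsD' : surplus J H D ≤ e + 1 := by omega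
    by_cases hcov : nonMultiples x (2 ^ (e + 1)) ⊆ D
    · exact Or.inr ⟨D, hcov, hsD'⟩
    have hDcard := card_le_of_surplus_le J H hsD'
    have hDc := card_compl D
    obtain ⟨T, hTD, hTr, hT⟩ := exists_core hn hD
    have h₁ : #(T ∪ (Q \ D)) ≤ n := by
      have := card_union_le T (Q \ D)
      have := card_le_card (sdiff_subset : Q \ D ⊆ Q)
      omega
    obtain ⟨M, hTM, hMD, hMn⟩ := exists_subsuperset_card_eq
      (union_subset hTD (fun i hi => mem_compl.2 (mem_sdiff.1 hi).2)) h₁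
      (show n ≤ #Dᶜ by omega)
    refine Or.inl ⟨M, hMn, hT M (subset_union_left.trans hTM) hMD ?_⟩
    have hQM : Q \ D ⊆ M := subset_union_right.trans hTM
    have hMD₀ : M ⊆ D₀ᶜ := hMD.trans (compl_subset_compl.2 hDD)
    have hsplit := card_filter_add_card_filter_not (s := M)
      (fun i => i ∈ nonMultiples x (2 ^ (e + 1)))
    have hne : {i ∈ M | i ∈ nonMultiples x (2 ^ (e + 1))}.Nonempty ∧
        Even #{i ∈ M | i ∈ nonMultiples x (2 ^ (e + 1))} := by
      rcases hQ with rfl | rfl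
      · have h : {i ∈ M | i ∈ nonMultiples x (2 ^ (e + 1))} = O \ D := by
          ext i
          have h₁ := @hQM i
          have h₂ := @hMD i
          have h₃ := @hDD i
          simp only [hO, mem_filter, mem_sdiff, mem_compl] at *
          tauto
        rw [h]
        refine ⟨?_, hev⟩
        obtain ⟨i, hi, hiD⟩ := not_subset.1 hcov
        exact ⟨i, mem_sdiff.2 ⟨mem_sdiff.2 ⟨hi, fun h => hiD (hDD h)⟩, hiD⟩⟩
      · have h : {i ∈ M | i ∉ nonMultiples x (2 ^ (e + 1))} = E \ D := by
          ext i
          have h₁ := @hQM i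
          have h₂ := @hMD i
          have h₃ := @hDD i
          simp only [hE, mem_filter, mem_sdiff, mem_compl] at *
          tauto
        have := card_le_card (sdiff_subset : E \ D ⊆ E)
        rw [h] at hsplit
        rw [← card_pos]
        refine ⟨by omega, ?_⟩
        have hnev := even_iff_two_dvd.2 h2n
        rw [← hMn, ← hsplit, Nat.even_add] at hnev
        exact hnev.2 hev
    rw [← hfilter] at hne
    exact unitZeroSum_two_pow he (hdvd M hMD₀) hne.1 hne.2
  · push Not at hsmall
    have hOr := hsmall O (Or.inl rfl)
    have hEr := hsmall E (Or.inr rfl)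
    have hDcard := card_le_of_surplus_le J H (hsD₀.trans hsB)
    have hDc := card_compl D₀
    obtain ⟨T, hTD, hTr, hT⟩ := exists_core hn hD₀
    obtain ⟨o, hoO, hoT⟩ := exists_mem_notMem_of_card_lt_card (show #T < #O by omega)
    obtain ⟨o', hoO', hoT'⟩ := exists_mem_notMem_of_card_lt_card
      (show #(insert o T) < #O by have := card_insert_le o T; omega)
    obtain ⟨l, hlE, hlT⟩ := exists_mem_notMem_of_card_lt_card (show #T < #E by omega)
    simp only [hO, hE, mem_sdiff, mem_compl, mem_insert, not_or] at hoO hoO' hlE hoT'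
    have hlo : l ≠ o := fun h => hlE.2 (h ▸ hoO.1)
    have hlo' : l ≠ o' := fun h => hlE.2 (h ▸ hoO'.1)
    obtain ⟨W, hTW, hWD, hWn⟩ := exists_subsuperset_card_eq (n := n - 1)
      (show insert o' T ⊆ (D₀ᶜ.erase o).erase l by
        intro i hi
        simp only [mem_erase, mem_compl]
        rcases mem_insert.1 hi with rfl | hi
        · exact ⟨hlo'.symm, hoT'.1, hoO'.2⟩
        · exact ⟨fun h => hlT (h ▸ hi), fun h => hoT (h ▸ hi), mem_compl.1 (hTD hi)⟩)
      (by have := card_insert_le o' T; omega)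
      (by
        rw [card_erase_of_mem (mem_erase.2 ⟨hlo, mem_compl.2 hlE.1⟩),
          card_erase_of_mem (mem_compl.2 hoO.2)]
        omega)
    have hoW : o ∉ W := fun h => by simpa using hWD h
    have hlW : l ∉ W := fun h => by simpa using hWD h
    have hWD₀ : W ⊆ D₀ᶜ := hWD.trans ((erase_subset _ _).trans (erase_subset _ _))
    have hne : ∀ M, W ⊆ M → {i ∈ M | ¬ 2 ^ (e + 1) ∣ x i}.Nonempty := fun M hM =>
      ⟨o', mem_filter.2 ⟨hM (hTW (mem_insert_self _ _)), mem_nonMultiples.1 hoO'.1⟩⟩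
    have hgood : ∀ i ∉ D₀, i ∉ W → Even #{i ∈ insert i W | ¬ 2 ^ (e + 1) ∣ x i} →
        ∃ M : Finset ι, #M = n ∧ UnitZeroSum n M x := by
      intro i hiD hiW hev
      have hsub : insert i W ⊆ D₀ᶜ := insert_subset (mem_compl.2 hiD) hWD₀
      refine ⟨insert i W, by rw [card_insert_of_notMem hiW]; omega,
        hT _ ((subset_insert _ _).trans (hTW.trans (subset_insert _ _))) hsub ?_⟩
      exact unitZeroSum_two_pow he (hdvd _ hsub) (hne _ (subset_insert _ _)) hev
    left
    by_cases hev : Even #{i ∈ W | ¬ 2 ^ (e + 1) ∣ x i}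
    · refine hgood l hlE.1 hlW ?_
      rw [filter_insert, if_neg (fun h => hlE.2 (mem_nonMultiples.2 h))]
      exact hev
    · refine hgood o hoO.2 hoW ?_
      rw [filter_insert, if_pos (mem_nonMultiples.1 hoO.1), card_insert_of_notMem (by simp [hoW]),
        Nat.even_add_one]
      exact hev

theorem exists_card_eq_unitZeroSum {n : ℕ} (hn : n ≠ 0) (x : ι → ℕ)
    (hcard : Fintype.card ι = n + (Nat.primeFactorsList n).length) :
    ∃ M : Finset ι, #M = n ∧ UnitZeroSum n M x := by
  by_contra hcon
  have key : ∀ e ≤ n.factorization 2, ∃ B, nonMultiples x (2 ^ e) ⊆ B ∧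
      surplus (oddPrimePowers n) (fun j => nonMultiples x (j.1 ^ (j.2 + 1))) B ≤ e := by
    intro e he
    induction e with
    | zero =>
      refine ⟨∅, fun i hi => absurd (mem_nonMultiples.1 hi) (by simp), ?_⟩
      simp [surplus]
    | succ e ih =>
      obtain ⟨B, hB, hsB⟩ := ih (by omega)
      push_cast
      exact (exists_unitZeroSum_or_exists_surplus_le hn hcard he hB hsB).resolve_left hcon
  obtain ⟨B, hB, hsB⟩ := key _ le_rfl
  obtain ⟨D, hBD, hD, hsD⟩ := exists_isHyperclosed_surplus_le (oddPrimePowers n)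
    (fun j => nonMultiples x (j.1 ^ (j.2 + 1))) B
  have hDcard := card_le_of_surplus_le _ _ (hsD.trans hsB)
  have hDc := card_compl D
  have hΩ := card_oddPrimePowers_add n
  have hbig := two_mul_card_add_one_le hn
  obtain ⟨T, hTD, hTr, hT⟩ := exists_core hn hD
  obtain ⟨M, hTM, hMD, hMn⟩ := exists_subsuperset_card_eq hTD
    (show #T ≤ n by omega) (show n ≤ #Dᶜ by omega)
  refine hcon ⟨M, hMn, hT M hTM hMD (unitZeroSum_of_forall_dvd fun i hi => ?_)⟩
  by_contra h
  exact mem_compl.1 (hMD hi) (hBD (hB (mem_nonMultiples.2 h)))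

end Selection

section Lists

/-- A set of `n` indices whose terms sum to zero with unit weights gives a weighted
subsequence. -/
theorem hasWZSS_of_unitZeroSum {n : ℕ} (hn : 0 < n) {S : List (ZMod n)} {M : Finset (Fin S.length)}
    (hM : #M = n) (h : UnitZeroSum n M fun i => (S.get i).val) : HasWZSS (U n) S n := by
  have : NeZero n := ⟨hn.ne'⟩
  obtain ⟨w, hw, hsum⟩ := h
  have hnodup : ((List.finRange S.length).filter (· ∈ M)).Nodup :=
    (List.nodup_finRange _).filter _
  have hfin : ((List.finRange S.length).filter (· ∈ M)).toFinset = M := by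
    ext i
    simp
  refine ⟨hn, ((List.finRange S.length).filter (· ∈ M)).map S.get, ?_, ?_,
    ((List.finRange S.length).filter (· ∈ M)).map fun i => (w i : ZMod n), by simp, ?_, ?_⟩
  · have := (List.filter_sublist (p := (· ∈ M)) (l := List.finRange S.length)).map S.get
    rwa [List.map_get_finRange] at this
  · rw [List.length_map, ← List.toFinset_card_of_nodup hnodup, hfin, hM]
  · intro a ha
    obtain ⟨i, -, rfl⟩ := List.mem_map.1 ha
    exact (ZMod.isUnit_iff_coprime _ _).2 (hw i)
  · rw [List.zipWith_map_left, List.zipWith_map_right, List.zipWith_self,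
      ← List.sum_toFinset _ hnodup, hfin]
    rw [← ZMod.natCast_eq_zero_iff] at hsum
    push_cast at hsum
    simpa using hsum

/-- The products of the proper initial segments of a list of natural numbers. -/
def initialProducts : List ℕ → List ℕ
  | [] => []
  | p :: l => 1 :: (initialProducts l).map (p * ·)

theorem length_initialProducts (l : List ℕ) : (initialProducts l).length = l.length := by
  induction l with
  | nil => rfl
  | cons p l ih => simp [initialProducts, ih]

theorem sum_zipWith_map_mul (p : ℕ) (w T : List ℕ) :
    (List.zipWith (· * ·) w (T.map (p * ·))).sum = p * (List.zipWith (· * ·) w T).sum := by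
  induction w generalizing T with
  | nil => simp
  | cons a w ih =>
    cases T with
    | nil => simp
    | cons t T =>
      simp only [List.map_cons, List.zipWith_cons_cons, List.sum_cons, ih]
      ring

theorem not_prod_dvd_sum_of_sublist_initialProducts {l : List ℕ} (hl : ∀ p ∈ l, 1 < p)
    {T : List ℕ} (hT : T.Sublist (initialProducts l)) (hne : T ≠ []) {w : List ℕ}
    (hlen : w.length = T.length) (hw : ∀ a ∈ w, a.Coprime l.prod) :
    ¬ l.prod ∣ (List.zipWith (· * ·) w T).sum := by
  induction l generalizing T with
  | nil => exact absurd (List.sublist_nil.1 hT) hne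
  | cons p l ih =>
    have hp := hl p List.mem_cons_self
    simp only [List.prod_cons] at hw ⊢
    rcases List.sublist_cons_iff.1 hT with h | ⟨T', rfl, h⟩
    · obtain ⟨T', hT', rfl⟩ := List.sublist_map_iff.1 h
      rw [sum_zipWith_map_mul, Nat.mul_dvd_mul_iff_left (by omega)]
      exact ih (fun q hq => hl q (List.mem_cons_of_mem _ hq)) hT' (by simpa using hne)
        (by simpa using hlen) fun a ha => (hw a ha).coprime_mul_left_right
    · obtain ⟨T', hT', rfl⟩ := List.sublist_map_iff.1 h
      cases w with
      | nil => simp at hlen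
      | cons a w =>
        intro hd
        simp only [List.zipWith_cons_cons, List.sum_cons, sum_zipWith_map_mul, mul_one] at hd
        have hpa : p ∣ a := (Nat.dvd_add_left (dvd_mul_right p _)).1 ((dvd_mul_right p _).trans hd)
        have := Nat.Coprime.eq_one_of_dvd
          ((hw a List.mem_cons_self).coprime_mul_right_right).symm hpa
        omega

theorem sum_zipWith_replicate_zero {R : Type*} [Semiring R] (w : List R) (k : ℕ) :
    (List.zipWith (· * ·) w (List.replicate k 0)).sum = 0 := by
  refine List.sum_eq_zero fun a ha => ?_
  obtain ⟨i, hi, rfl⟩ := List.mem_iff_getElem.1 ha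
  simp

theorem cast_sum_zipWith_val {n : ℕ} [NeZero n] (w : List (ZMod n)) (T : List ℕ) :
    (((List.zipWith (· * ·) (w.map ZMod.val) T).sum : ℕ) : ZMod n)
      = (List.zipWith (· * ·) w (T.map Nat.cast)).sum := by
  induction w generalizing T with
  | nil => simp
  | cons a w ih =>
    cases T with
    | nil => simp
    | cons t T => simp [ih]

/-- The initial products of the prime factors of `n`, followed by `n - 1` zeros, have no
unit-weighted zero-sum subsequence of length `n`. -/
theorem not_hasWZSS_initialProducts {n : ℕ} (hn : 0 < n) :
    ¬ HasWZSS (U n) ((initialProducts n.primeFactorsList).map Nat.cast ++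
      List.replicate (n - 1) (0 : ZMod n)) n := by
  have : NeZero n := ⟨hn.ne'⟩
  rintro ⟨-, T, hT, hTn, w, hwT, hwU, hsum⟩
  obtain ⟨T₁, T₂, rfl, hT₁, hT₂⟩ := List.sublist_append_iff.1 hT
  obtain ⟨T₁, hTl, rfl⟩ := List.sublist_map_iff.1 hT₁
  obtain ⟨k, hk, rfl⟩ := List.sublist_replicate_iff.1 hT₂
  simp only [List.length_append, List.length_map, List.length_replicate] at hTn hwT
  have hwlen : (w.take T₁.length).length = (T₁.map (Nat.cast : ℕ → ZMod n)).length := by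
    simp only [List.length_take, List.length_map]
    omega
  rw [← List.take_append_drop T₁.length w, List.zipWith_append hwlen, List.sum_append,
    sum_zipWith_replicate_zero, add_zero, ← cast_sum_zipWith_val, ZMod.natCast_eq_zero_iff] at hsum
  refine not_prod_dvd_sum_of_sublist_initialProducts (w := (w.take T₁.length).map ZMod.val)
    (fun p hp => (Nat.prime_of_mem_primeFactorsList hp).one_lt) hTl ?_
    (by rw [List.length_map, hwlen, List.length_map]) ?_ (by rwa [Nat.prod_primeFactorsList hn.ne'])
  · rintro rfl
    simp only [List.length_nil] at hTn
    omega
  · intro a ha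
    obtain ⟨b, hb, rfl⟩ := List.mem_map.1 ha
    rw [Nat.prod_primeFactorsList hn.ne', ← ZMod.isUnit_iff_coprime, ZMod.natCast_zmod_val]
    exact hwU b (List.mem_of_mem_take hb)

end Lists

/-- For every `n ≥ 2`, `E_{U(n)}(n) = n + Ω(n)`. -/
theorem gao_units_eq (n : ℕ) (hn : 2 ≤ n) :
    GaoC n (U n) = n + (Nat.primeFactorsList n).length := by
  have hmem : n + (Nat.primeFactorsList n).length ∈
      {k | 0 < k ∧ ∀ S : List (ZMod n), S.length = k → HasWZSS (U n) S n} := by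
    refine ⟨by omega, fun S hS => ?_⟩
    obtain ⟨M, hM, h⟩ := exists_card_eq_unitZeroSum (n := n) (by omega)
      (fun i : Fin S.length => (S.get i).val) (by simpa using hS)
    exact hasWZSS_of_unitZeroSum (by omega) hM h
  refine le_antisymm (Nat.sInf_le hmem) (le_csInf ⟨_, hmem⟩ fun k hk => ?_)
  by_contra! hlt
  have hlen : (((initialProducts n.primeFactorsList).map Nat.cast ++
      List.replicate (n - 1) (0 : ZMod n)).take k).length = k := by
    simp only [List.length_take, List.length_append, List.length_map, List.length_replicate,
      length_initialProducts]
    omega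
  obtain ⟨h0, T, hT, h⟩ := hk.2 _ hlen
  exact not_hasWZSS_initialProducts (by omega) ⟨h0, T, hT.trans (List.take_sublist _ _), h⟩
end
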